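/- arXiv:2508.01560 — 15 statements merged into one kernel-verified Lean document; each statement's English description precedes it below -/
import Mathlib

section
/- Let (L,[·,·]) be a Lie algebra over a field k and let ⋄ be a bilinear operation on L such that the curvature R vanishes identically and the torsion is constant, i.e. (x⋄T)(y,z) = 0 for all x,y,z ∈ L. Define ⟦x,y⟧ := [x,y] − (x⋄y − y⋄x) = −T(x,y). Then (L,⋄,⟦·,·⟧) is a post-Lie algebra: ⟦·,·⟧ is antisymmetric and satisfies the Jacobi identity, x⋄⟦y,z⟧ = ⟦x⋄y,z⟧ + ⟦y,x⋄z⟧, and ⟦x,y⟧⋄z = a_⋄(x,y,z) − a_⋄(y,x,z) for all x,y,z ∈ L. -/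
namespace Stmt1

variable {k L : Type*} [Field k] [AddCommGroup L] [Module k L]

/-- Associator of a binary operation. -/
def assoc (op : L → L → L) (x y z : L) : L :=
  op x (op y z) - op (op x y) z

/-- The torsion of a bilinear operation `d` ("⋄") on a Lie algebra `(L, br)`. -/
def torsion (d br : L →ₗ[k] L →ₗ[k] L) (x y : L) : L :=
  d x y - d y x - br x y

/-- The curvature of a bilinear operation `d` ("⋄") on a Lie algebra `(L, br)`. -/
def curvature (d br : L →ₗ[k] L →ₗ[k] L) (x y z : L) : L :=
  d x (d y z) - d y (d x z) - d (br x y) z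

/-- The `⋄`-covariant derivative of the torsion along `x`. -/
def covT (d br : L →ₗ[k] L →ₗ[k] L) (x y z : L) : L :=
  d x (torsion d br y z) - torsion d br (d x y) z - torsion d br y (d x z)

/-- The deformed bracket `⟦x,y⟧ := [x,y] − (x⋄y − y⋄x) = −T(x,y)`. -/
def nb (d br : L →ₗ[k] L →ₗ[k] L) (x y : L) : L :=
  br x y - (d x y - d y x)

/-- **Geometric post-Lie deformation of a Lie algebra**: if `⋄` has null curvature
and constant torsion on the Lie algebra `(L, br)`, then `(L, ⋄, ⟦·,·⟧)` is a post-Lie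
algebra. -/
theorem gpl_deformation_of_Lie (d br : L →ₗ[k] L →ₗ[k] L)
    (h_anti : ∀ x y : L, br x y = - br y x)
    (h_jacobi : ∀ x y z : L, br x (br y z) + br z (br x y) + br y (br z x) = 0)
    (h_flat : ∀ x y z : L, curvature d br x y z = 0)
    (h_const : ∀ x y z : L, covT d br x y z = 0) :
    (∀ x y : L, nb d br x y = - nb d br y x)
    ∧ (∀ x y z : L,
        nb d br x (nb d br y z) + nb d br z (nb d br x y) + nb d br y (nb d br z x) = 0)
    ∧ (∀ x y z : L, d x (nb d br y z) = nb d br (d x y) z + nb d br y (d x z))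
    ∧ (∀ x y z : L, d (nb d br x y) z
        = assoc (fun u v => d u v) x y z - assoc (fun u v => d u v) y x z) := by
  have h_der : ∀ x y z : L, d x (nb d br y z) = nb d br (d x y) z + nb d br y (d x z) := by
    intro x y z
    have h := h_const x y z
    simp only [covT, torsion, nb, map_sub] at h ⊢
    linear_combination (norm := module) -h
  refine ⟨fun x y => ?_, fun x y z => ?_, h_der, fun x y z => ?_⟩
  · simp only [nb]
    linear_combination (norm := module) h_anti x y
  · have hx := h_der x y z
    have hy := h_der y z x
    have hz := h_der z x y
    have fx := h_flat y z x
    have fy := h_flat z x y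
    have fz := h_flat x y z
    simp only [nb, curvature, map_sub, LinearMap.sub_apply] at hx hy hz fx fy fz ⊢
    linear_combination (norm := module) h_jacobi x y z - hx - hy - hz - fx - fy - fz
      - h_anti (d x y) z - h_anti (d y z) x - h_anti (d z x) y
  · have h := h_flat x y z
    simp only [nb, curvature, assoc, map_sub, LinearMap.sub_apply] at h ⊢
    linear_combination (norm := module) -h

end Stmt1
end

section
/- Let (L,▷,[·,·]) be a post-Lie algebra over a field k and let ⋄ be a bilinear operation on L satisfying: (i) (x⋄T)(y,z) = 0 for all x,y,z ∈ L (constant torsion), (ii) R(x,y,z) = 0 for all x,y,z ∈ L (flatness), and (iii) for every x ∈ L, x▷· is a derivation of (L,⋄). Define x▸y := x▷y + x⋄y and ⟦x,y⟧ := [x,y] − (x⋄y − y⋄x). Then (L,▸,⟦·,·⟧) is a post-Lie algebra: ⟦·,·⟧ is antisymmetric and satisfies the Jacobi identity, x▸⟦y,z⟧ = ⟦x▸y,z⟧ + ⟦y,x▸z⟧, and ⟦x,y⟧▸z = a_▸(x,y,z) − a_▸(y,x,z) for all x,y,z ∈ L. -/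
namespace Stmt2

variable {k L : Type*} [Field k] [AddCommGroup L] [Module k L]

/-- Associator of a binary operation. -/
def assoc (op : L → L → L) (x y z : L) : L :=
  op x (op y z) - op (op x y) z

/-- The torsion of a bilinear operation `d` ("⋄") on a Lie algebra `(L, br)`. -/
def torsion (d br : L →ₗ[k] L →ₗ[k] L) (x y : L) : L :=
  d x y - d y x - br x y

/-- The curvature of a bilinear operation `d` ("⋄") on a Lie algebra `(L, br)`. -/
def curvature (d br : L →ₗ[k] L →ₗ[k] L) (x y z : L) : L :=
  d x (d y z) - d y (d x z) - d (br x y) z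

/-- The `⋄`-covariant derivative of the torsion along `x`. -/
def covT (d br : L →ₗ[k] L →ₗ[k] L) (x y z : L) : L :=
  d x (torsion d br y z) - torsion d br (d x y) z - torsion d br y (d x z)

/-- The deformed product `x▸y := x▷y + x⋄y`. -/
def btr (tr d : L →ₗ[k] L →ₗ[k] L) (x y : L) : L :=
  tr x y + d x y

/-- The deformed bracket `⟦x,y⟧ := [x,y] − (x⋄y − y⋄x)`. -/
def nb (d br : L →ₗ[k] L →ₗ[k] L) (x y : L) : L :=
  br x y - (d x y - d y x)

/-- **Geometric post-Lie deformation of a post-Lie algebra**: if `(L, tr, br)` is a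
post-Lie algebra and `⋄` has constant torsion, null curvature and each `x ▷ ·` is a
derivation of `(L, ⋄)`, then `(L, ▸, ⟦·,·⟧)` is a post-Lie algebra. -/
theorem gpl_deformation_of_postLie (tr br d : L →ₗ[k] L →ₗ[k] L)
    -- `(L, tr, br)` is a post-Lie algebra:
    (h_anti : ∀ x y : L, br x y = - br y x)
    (h_jacobi : ∀ x y z : L, br x (br y z) + br z (br x y) + br y (br z x) = 0)
    (h_der : ∀ x y z : L, tr x (br y z) = br (tr x y) z + br y (tr x z))
    (h_assoc : ∀ x y z : L, tr (br x y) z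
        = assoc (fun u v => tr u v) x y z - assoc (fun u v => tr u v) y x z)
    -- compatibility conditions on `⋄`:
    (h_const : ∀ x y z : L, covT d br x y z = 0)
    (h_flat : ∀ x y z : L, curvature d br x y z = 0)
    (h_derd : ∀ x y z : L, tr x (d y z) = d (tr x y) z + d y (tr x z)) :
    (∀ x y : L, nb d br x y = - nb d br y x)
    ∧ (∀ x y z : L,
        nb d br x (nb d br y z) + nb d br z (nb d br x y) + nb d br y (nb d br z x) = 0)
    ∧ (∀ x y z : L, btr tr d x (nb d br y z)
        = nb d br (btr tr d x y) z + nb d br y (btr tr d x z))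
    ∧ (∀ x y z : L, btr tr d (nb d br x y) z
        = assoc (btr tr d) x y z - assoc (btr tr d) y x z) := by
  simp only [covT, torsion, curvature, assoc, nb, btr, map_sub, map_add,
    LinearMap.sub_apply, LinearMap.add_apply] at *
  refine ⟨fun x y => ?_, fun x y z => ?_, fun x y z => ?_, fun x y z => ?_⟩
  · linear_combination (norm := abel) h_anti x y
  · linear_combination (norm := abel) h_jacobi x y z
      + h_const x y z + h_const y z x + h_const z x y
      - h_flat x y z - h_flat y z x - h_flat z x y
      - h_anti (d x y) z - h_anti (d y z) x - h_anti (d z x) y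
  · linear_combination (norm := abel) h_der x y z - h_derd x y z + h_derd x z y - h_const x y z
  · linear_combination (norm := abel) h_assoc x y z - h_flat x y z - h_derd x y z + h_derd y x z

end Stmt2
end

section
/- Let (L,▷,[·,·]) be a post-Lie algebra over a field k and let ⋄ be a bilinear operation on L such that for every x ∈ L, x▷· is a derivation of (L,⋄). Define x▸y := x▷y + x⋄y and ⟦x,y⟧ := [x,y] − (x⋄y − y⋄x). Then for all x,y,z ∈ L: a_▸(x,y,z) − a_▸(y,x,z) = ⟦x,y⟧▸z + R(x,y,z), where R(x,y,z) := x⋄(y⋄z) − y⋄(x⋄z) − [x,y]⋄z is the curvature of ⋄ on (L,[·,·]). -/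
namespace Stmt5

variable {k L : Type*} [Field k] [AddCommGroup L] [Module k L]

/-- Associator of a binary operation. -/
def assoc (op : L → L → L) (x y z : L) : L :=
  op x (op y z) - op (op x y) z

/-- The curvature of a bilinear operation `d` ("⋄") on a Lie algebra `(L, br)`. -/
def curvature (d br : L →ₗ[k] L →ₗ[k] L) (x y z : L) : L :=
  d x (d y z) - d y (d x z) - d (br x y) z

/-- The deformed product `x▸y := x▷y + x⋄y`. -/
def btr (tr d : L →ₗ[k] L →ₗ[k] L) (x y : L) : L :=
  tr x y + d x y

/-- The deformed bracket `⟦x,y⟧ := [x,y] − (x⋄y − y⋄x)`. -/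
def nb (d br : L →ₗ[k] L →ₗ[k] L) (x y : L) : L :=
  br x y - (d x y - d y x)

/-- **Curvature identity**: the skew-symmetrized associator of `▸` equals
`⟦x,y⟧ ▸ z` plus the curvature. -/
theorem curvature_identity (tr br d : L →ₗ[k] L →ₗ[k] L)
    -- `(L, tr, br)` is a post-Lie algebra:
    (h_anti : ∀ x y : L, br x y = - br y x)
    (h_jacobi : ∀ x y z : L, br x (br y z) + br z (br x y) + br y (br z x) = 0)
    (h_der : ∀ x y z : L, tr x (br y z) = br (tr x y) z + br y (tr x z))
    (h_assoc : ∀ x y z : L, tr (br x y) z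
        = assoc (fun u v => tr u v) x y z - assoc (fun u v => tr u v) y x z)
    -- `x ▷ ·` is a derivation of `(L, ⋄)`:
    (h_derd : ∀ x y z : L, tr x (d y z) = d (tr x y) z + d y (tr x z)) :
    ∀ x y z : L,
      assoc (btr tr d) x y z - assoc (btr tr d) y x z
        = btr tr d (nb d br x y) z + curvature d br x y z := by
  intro x y z
  have h := h_assoc x y z
  simp only [assoc] at h
  simp only [assoc, btr, nb, curvature, map_add, map_sub, LinearMap.add_apply,
    LinearMap.sub_apply, h, h_derd]
  abel

end Stmt5
end

section
/- Let (L,▷,[·,·]) be a post-Lie algebra over a field k and define the bilinear operation x▸y := x▷y + [x,y]. Then the adjoint (L,▸,−[·,·]) is also a post-Lie algebra: −[·,·] is a Lie bracket, x▸(−[y,z]) = −[x▸y,z] − [y,x▸z], and −[x,y]▸z = a_▸(x,y,z) − a_▸(y,x,z) for all x,y,z ∈ L. Moreover taking the adjoint is an involution: applying the same construction to (L,▸,−[·,·]) returns (L,▷,[·,·]). -/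
namespace Stmt7

variable {k L : Type*} [Field k] [AddCommGroup L] [Module k L]

/-- Associator of a binary operation. -/
def assoc (op : L → L → L) (x y z : L) : L :=
  op x (op y z) - op (op x y) z

/-- The adjoint product `x▸y := x▷y + [x,y]`. -/
def badj (tr br : L →ₗ[k] L →ₗ[k] L) (x y : L) : L :=
  tr x y + br x y

/-- The opposite bracket `−[·,·]`. -/
def mbr (br : L →ₗ[k] L →ₗ[k] L) (x y : L) : L :=
  - br x y

/-- **Adjoint post-Lie algebra**: if `(L, ▷, [·,·])` is post-Lie, so is
`(L, ▸, −[·,·])` where `x▸y := x▷y + [x,y]`, and taking adjoints is an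
involution. -/
theorem adjoint_postLie (tr br : L →ₗ[k] L →ₗ[k] L)
    -- `(L, tr, br)` is a post-Lie algebra:
    (h_anti : ∀ x y : L, br x y = - br y x)
    (h_jacobi : ∀ x y z : L, br x (br y z) + br z (br x y) + br y (br z x) = 0)
    (h_der : ∀ x y z : L, tr x (br y z) = br (tr x y) z + br y (tr x z))
    (h_assoc : ∀ x y z : L, tr (br x y) z
        = assoc (fun u v => tr u v) x y z - assoc (fun u v => tr u v) y x z) :
    -- `−[·,·]` is a Lie bracket:
    (∀ x y : L, mbr br x y = - mbr br y x)
    ∧ (∀ x y z : L,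
        mbr br x (mbr br y z) + mbr br z (mbr br x y) + mbr br y (mbr br z x) = 0)
    -- `▸` is a derivation of `−[·,·]`:
    ∧ (∀ x y z : L, badj tr br x (mbr br y z)
        = mbr br (badj tr br x y) z + mbr br y (badj tr br x z))
    -- associator condition for `(▸, −[·,·])`:
    ∧ (∀ x y z : L, badj tr br (mbr br x y) z
        = assoc (badj tr br) x y z - assoc (badj tr br) y x z)
    -- taking the adjoint is an involution:
    ∧ (∀ x y : L, badj tr br x y + mbr br x y = tr x y)
    ∧ (∀ x y : L, - mbr br x y = br x y) := by
  refine ⟨fun x y => ?_, fun x y z => ?_, fun x y z => ?_, fun x y z => ?_, fun x y => ?_,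
    fun x y => ?_⟩
  · simp only [mbr, h_anti x y]
  · simpa only [mbr, map_neg, neg_neg] using h_jacobi x y z
  · have h := h_jacobi x y z
    rw [h_anti z (br x y), h_anti z x, map_neg] at h
    simp only [badj, mbr, map_neg, map_add, LinearMap.add_apply, h_der]
    linear_combination (norm := abel) -h
  · have h := h_jacobi x y z
    rw [h_anti z (br x y), h_anti z x, map_neg] at h
    have ha := h_assoc x y z
    simp only [assoc] at ha
    simp only [assoc, badj, mbr, map_neg, map_add, LinearMap.add_apply, LinearMap.neg_apply,
      h_der, h_anti y x]
    linear_combination (norm := abel) ha - h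
  · simp only [badj, mbr, add_neg_cancel_right]
  · simp only [mbr, neg_neg]

end Stmt7
end

section
/- Let (L,⋄) be a pre-Lie algebra over a field k and let ▷ be a bilinear operation on L such that for every x ∈ L, x▷· is a derivation of (L,⋄). If (L,▷,[·,·]_⋄) is a post-Lie algebra (where [x,y]_⋄ := x⋄y − y⋄x), then (L,▷+⋄) is a pre-Lie algebra, i.e. the operation x▸y := x▷y + x⋄y satisfies a_▸(x,y,z) = a_▸(y,x,z) for all x,y,z ∈ L. -/
namespace Stmt8

variable {k L : Type*} [Field k] [AddCommGroup L] [Module k L]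

/-- Associator of a binary operation. -/
def assoc (op : L → L → L) (x y z : L) : L :=
  op x (op y z) - op (op x y) z

/-- The commutator `[x,y]_⋄ := x⋄y − y⋄x`. -/
def comm (d : L →ₗ[k] L →ₗ[k] L) (x y : L) : L :=
  d x y - d y x

/-- The deformed product `x▸y := x▷y + x⋄y`. -/
def btr (tr d : L →ₗ[k] L →ₗ[k] L) (x y : L) : L :=
  tr x y + d x y

/-- **Pre-Lie deformation** (forward direction): if `(L,⋄)` is pre-Lie, each
`x▷·` is a derivation of `(L,⋄)`, and `(L,▷,[·,·]_⋄)` is post-Lie, then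
`(L,▷+⋄)` is pre-Lie. -/
theorem preLie_deformation (tr d : L →ₗ[k] L →ₗ[k] L)
    -- `(L, d)` is a pre-Lie algebra:
    (h_pre : ∀ x y z : L,
      assoc (fun u v => d u v) x y z = assoc (fun u v => d u v) y x z)
    -- `x ▷ ·` is a derivation of `(L, ⋄)`:
    (h_derd : ∀ x y z : L, tr x (d y z) = d (tr x y) z + d y (tr x z))
    -- `(L, tr, [·,·]_⋄)` is a post-Lie algebra:
    (h_anti : ∀ x y : L, comm d x y = - comm d y x)
    (h_jacobi : ∀ x y z : L,
      comm d x (comm d y z) + comm d z (comm d x y) + comm d y (comm d z x) = 0)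
    (h_der : ∀ x y z : L, tr x (comm d y z) = comm d (tr x y) z + comm d y (tr x z))
    (h_assoc : ∀ x y z : L, tr (comm d x y) z
        = assoc (fun u v => tr u v) x y z - assoc (fun u v => tr u v) y x z) :
    ∀ x y z : L, assoc (btr tr d) x y z = assoc (btr tr d) y x z := by
  intro x y z
  have hp := h_pre x y z
  have ha := h_assoc x y z
  simp only [assoc, comm, btr, map_add, map_sub, LinearMap.add_apply, LinearMap.sub_apply,
    h_derd] at hp ha ⊢
  linear_combination (norm := module) hp - ha

end Stmt8
end

section
/- Let (L,⋄) be a pre-Lie algebra over a field k and let ▷ be a bilinear operation on L such that for every x ∈ L, x▷· is a derivation of (L,⋄). Suppose moreover that [x,y]_⋄ ⋄ z = 0 for all x,y,z ∈ L, where [x,y]_⋄ := x⋄y − y⋄x. If (L,▷+⋄) is a pre-Lie algebra (i.e. x▸y := x▷y + x⋄y has symmetric associator a_▸(x,y,z) = a_▸(y,x,z)), then (L,▷,[·,·]_⋄) is a post-Lie algebra: [·,·]_⋄ is a Lie bracket, x▷[y,z]_⋄ = [x▷y,z]_⋄ + [y,x▷z]_⋄, and [x,y]_⋄▷z = a_▷(x,y,z)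 − a_▷(y,x,z) for all x,y,z ∈ L. -/
namespace Stmt9

variable {k L : Type*} [Field k] [AddCommGroup L] [Module k L]

/-- Associator of a binary operation. -/
def assoc (op : L → L → L) (x y z : L) : L :=
  op x (op y z) - op (op x y) z

/-- The commutator `[x,y]_⋄ := x⋄y − y⋄x`. -/
def comm (d : L →ₗ[k] L →ₗ[k] L) (x y : L) : L :=
  d x y - d y x

/-- The deformed product `x▸y := x▷y + x⋄y`. -/
def btr (tr d : L →ₗ[k] L →ₗ[k] L) (x y : L) : L :=
  tr x y + d x y

/-- **Pre-Lie deformation** (reverse direction): if `(L,⋄)` is pre-Lie, each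
`x▷·` is a derivation of `(L,⋄)`, `[x,y]_⋄ ⋄ z = 0`, and `(L,▷+⋄)` is pre-Lie,
then `(L,▷,[·,·]_⋄)` is a post-Lie algebra. -/
theorem preLie_deformation_reverse (tr d : L →ₗ[k] L →ₗ[k] L)
    -- `(L, d)` is a pre-Lie algebra:
    (h_pre : ∀ x y z : L,
      assoc (fun u v => d u v) x y z = assoc (fun u v => d u v) y x z)
    -- `x ▷ ·` is a derivation of `(L, ⋄)`:
    (h_derd : ∀ x y z : L, tr x (d y z) = d (tr x y) z + d y (tr x z))
    -- extra hypothesis `[x,y]_⋄ ⋄ z = 0`: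
    (h_extra : ∀ x y z : L, d (comm d x y) z = 0)
    -- `(L, ▷+⋄)` is a pre-Lie algebra:
    (h_pre' : ∀ x y z : L, assoc (btr tr d) x y z = assoc (btr tr d) y x z) :
    -- `[·,·]_⋄` is a Lie bracket:
    (∀ x y : L, comm d x y = - comm d y x)
    ∧ (∀ x y z : L,
        comm d x (comm d y z) + comm d z (comm d x y) + comm d y (comm d z x) = 0)
    -- `▷` is a derivation of `[·,·]_⋄`:
    ∧ (∀ x y z : L, tr x (comm d y z) = comm d (tr x y) z + comm d y (tr x z))
    -- associator condition:
    ∧ (∀ x y z : L, tr (comm d x y) z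
        = assoc (fun u v => tr u v) x y z - assoc (fun u v => tr u v) y x z) := by
  refine ⟨fun x y => (neg_sub _ _).symm, fun x y z => ?_, fun x y z => ?_, fun x y z => ?_⟩
  · have h₁ := h_pre x y z
    have h₂ := h_pre y z x
    have h₃ := h_pre z x y
    simp only [assoc, comm, map_sub, LinearMap.sub_apply] at *
    linear_combination (norm := module) h₁ + h₂ + h₃
  · simp only [comm, map_sub, h_derd]
    abel
  · have h₁ := h_pre x y z
    have h₂ := h_pre' x y z
    simp only [assoc, btr, comm, map_add, map_sub, LinearMap.add_apply, LinearMap.sub_apply,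
      h_derd] at *
    linear_combination (norm := module) h₁ - h₂

end Stmt9
end

section
/- Let k be a field and A a commutative associative unital k-algebra, and set L := A ⊗[k] Der(A). Let ▷ and [·,·] be the bilinear operations on L determined on pure tensors by (a₁⊗D₁) ▷ (a₂⊗D₂) := (a₁·D₁(a₂)) ⊗ D₂ and [a₁⊗D₁, a₂⊗D₂] := (a₁a₂) ⊗ ⁅D₁,D₂⁆. Then (L,▷,[·,·]) is a (left) post-Lie algebra: [·,·] is antisymmetric and satisfies the Jacobi identity, x▷[y,z] = [x▷y,z] + [y,x▷z], and [x,y]▷z = a_▷(x,y,z) − a_▷(y,x,z) for all x,y,z ∈ L. -/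
namespace Stmt10

open TensorProduct

variable {k A : Type*} [Field k] [CommRing A] [Algebra k A]

/-- Associator of a binary operation. -/
def assoc {M : Type*} [AddCommGroup M] (op : M → M → M) (x y z : M) : M :=
  op x (op y z) - op (op x y) z

/-- **The J–Z canonical post-Lie algebra on `A ⊗ Der(A)`**: the bilinear
operations determined on pure tensors by
`(a₁⊗D₁) ▷ (a₂⊗D₂) = (a₁·D₁(a₂)) ⊗ D₂` and
`[a₁⊗D₁, a₂⊗D₂] = (a₁a₂) ⊗ ⁅D₁,D₂⁆` form a post-Lie algebra. -/
theorem jz_postLie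
    (tr br : (A ⊗[k] Derivation k A A) →ₗ[k]
      (A ⊗[k] Derivation k A A) →ₗ[k] (A ⊗[k] Derivation k A A))
    (htr : ∀ (a₁ a₂ : A) (D₁ D₂ : Derivation k A A),
      tr (a₁ ⊗ₜ[k] D₁) (a₂ ⊗ₜ[k] D₂) = (a₁ * D₁ a₂) ⊗ₜ[k] D₂)
    (hbr : ∀ (a₁ a₂ : A) (D₁ D₂ : Derivation k A A),
      br (a₁ ⊗ₜ[k] D₁) (a₂ ⊗ₜ[k] D₂) = (a₁ * a₂) ⊗ₜ[k] ⁅D₁, D₂⁆) :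
    (∀ x y, br x y = - br y x)
    ∧ (∀ x y z, br x (br y z) + br z (br x y) + br y (br z x) = 0)
    ∧ (∀ x y z, tr x (br y z) = br (tr x y) z + br y (tr x z))
    ∧ (∀ x y z, tr (br x y) z
        = assoc (fun u v => tr u v) x y z - assoc (fun u v => tr u v) y x z) := by
  refine ⟨fun x y => ?_, fun x y z => ?_, fun x y z => ?_, fun x y z => ?_⟩
  · induction x with
    | zero => simp
    | add x₁ x₂ h₁ h₂ =>
      simp only [map_add, LinearMap.add_apply, h₁, h₂]
      abel
    | tmul a D =>
      induction y with
      | zero => simp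
      | add y₁ y₂ h₁ h₂ =>
        simp only [map_add, LinearMap.add_apply, h₁, h₂]
        abel
      | tmul b E => rw [hbr, hbr, ← lie_skew D E, tmul_neg, mul_comm]
  · rw [add_assoc, add_eq_zero_iff_eq_neg]
    induction x with
    | zero => simp
    | add x₁ x₂ h₁ h₂ =>
      simp only [map_add, LinearMap.add_apply, h₁, h₂]
      abel
    | tmul a D =>
      induction y with
      | zero => simp
      | add y₁ y₂ h₁ h₂ =>
        simp only [map_add, LinearMap.add_apply, h₁, h₂]
        abel
      | tmul b E =>
        induction z with
        | zero => simp
        | add z₁ z₂ h₁ h₂ =>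
          simp only [map_add, LinearMap.add_apply, h₁, h₂]
          abel
        | tmul c F =>
          rw [← add_eq_zero_iff_eq_neg, ← add_assoc]
          simp only [hbr]
          rw [show c * (a * b) = a * (b * c) by ring, show b * (c * a) = a * (b * c) by ring,
            ← tmul_add, ← tmul_add, add_right_comm, lie_jacobi, tmul_zero]
  · induction x with
    | zero => simp
    | add x₁ x₂ h₁ h₂ =>
      simp only [map_add, LinearMap.add_apply, h₁, h₂]
      abel
    | tmul a D =>
      induction y with
      | zero => simp
      | add y₁ y₂ h₁ h₂ =>
        simp only [map_add, LinearMap.add_apply, h₁, h₂]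
        abel
      | tmul b E =>
        induction z with
        | zero => simp
        | add z₁ z₂ h₁ h₂ =>
          simp only [map_add, h₁, h₂]
          abel
        | tmul c F =>
          simp only [hbr, htr, ← add_tmul, Derivation.leibniz, smul_eq_mul]
          congr 1
          ring
  · simp only [assoc]
    induction x with
    | zero => simp
    | add x₁ x₂ h₁ h₂ =>
      simp only [map_add, LinearMap.add_apply, h₁, h₂]
      abel
    | tmul a D =>
      induction y with
      | zero => simp
      | add y₁ y₂ h₁ h₂ =>
        simp only [map_add, LinearMap.add_apply, h₁, h₂]
        abel
      | tmul b E =>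
        induction z with
        | zero => simp
        | add z₁ z₂ h₁ h₂ =>
          simp only [map_add, h₁, h₂]
          abel
        | tmul c F =>
          simp only [hbr, htr, ← sub_tmul, Derivation.leibniz, Derivation.commutator_apply,
            smul_eq_mul]
          congr 1
          ring

end Stmt10
end

section
/- Let k be a field, A a commutative associative unital k-algebra, and 𝒟 ⊆ Der(A) a k-submodule closed under the commutator ⁅·,·⁆ of derivations. Let ⋄ : 𝒟 × 𝒟 → 𝒟 be a bilinear operation such that, with respect to the Lie bracket ⁅·,·⁆ on 𝒟, the curvature vanishes (D₁⋄(D₂⋄D₃) − D₂⋄(D₁⋄D₃) − ⁅D₁,D₂⁆⋄D₃ = 0 for all D₁,D₂,D₃ ∈ 𝒟) and the torsion T(D₁,D₂) := D₁⋄D₂ − D₂⋄D₁ − ⁅D₁,D₂⁆ is constant (D₁⋄(T(D₂,D₃)) − T(D₁⋄D₂,D₃) − T(D₂,D₁⋄D₃) = 0 for all D₁,D₂,D₃ ∈ 𝒟). Then the bilinear operations on A ⊗[k] 𝒟 determined on pure tensors by (a₁⊗D₁) ▸ (a₂⊗D₂) := (a₁·D₁(a₂)) ⊗ D₂ + (a₁a₂)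 ⊗ (D₁⋄D₂) and ⟦a₁⊗D₁, a₂⊗D₂⟧ := (a₁a₂) ⊗ (⁅D₁,D₂⁆ − D₁⋄D₂ + D₂⋄D₁) make (A⊗𝒟, ▸, ⟦·,·⟧) a post-Lie algebra: ⟦·,·⟧ is antisymmetric and satisfies the Jacobi identity, x▸⟦y,z⟧ = ⟦x▸y,z⟧ + ⟦y,x▸z⟧, and ⟦x,y⟧▸z = a_▸(x,y,z) − a_▸(y,x,z) for all x,y,z ∈ A⊗𝒟. -/
set_option synthInstance.maxHeartbeats 1000000
namespace Stmt11

open TensorProduct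

variable {k A : Type*} [Field k] [CommRing A] [Algebra k A]

/-- Associator of a binary operation. -/
def assoc {M : Type*} [AddCommGroup M] (op : M → M → M) (x y z : M) : M :=
  op x (op y z) - op (op x y) z

/-- First Bianchi identity: for a flat connection with constant torsion on a Lie algebra,
the opposite of the torsion satisfies the Jacobi identity. -/
theorem jacobi_neg_torsion {R L : Type*} [CommRing R] [AddCommGroup L] [Module R L]
    (br dia : L →ₗ[R] L →ₗ[R] L) (h_skew : ∀ x y, br x y = -br y x)
    (h_jacobi : ∀ x y z, br x (br y z) + br z (br x y) + br y (br z x) = 0)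
    (h_flat : ∀ x y z, dia x (dia y z) - dia y (dia x z) - dia (br x y) z = 0)
    (N : L → L → L) (hN : ∀ x y, N x y = br x y - dia x y + dia y x)
    (h_der : ∀ x y z, dia x (N y z) = N (dia x y) z + N y (dia x z)) (x y z : L) :
    N x (N y z) + N z (N x y) + N y (N z x) = 0 := by
  have hN_skew (u v : L) : N u v = -N v u := by
    rw [hN, hN, h_skew u v]; abel
  have hN_add (u v w : L) : N u (v + w) = N u v + N u w := by
    simp only [hN, map_add, LinearMap.add_apply]; abel
  have hN_sub (u v w : L) : N u (v - w) = N u v - N u w := by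
    simp only [hN, map_sub, LinearMap.sub_apply]; abel
  have h_cycle (u v w : L) : N u (N v w) = N u (br v w) + N (dia v w) u + N u (dia w v) := by
    rw [hN v w, hN_add, hN_sub, hN_skew (dia v w) u]; abel
  have h_expand (u v w : L) : N u (br v w) + dia u (N v w) =
      br u (br v w) + dia (br v w) u - dia u (dia v w) + dia u (dia w v) := by
    rw [hN u, hN v w, map_add, map_sub]; abel
  rw [h_cycle, h_cycle, h_cycle]
  linear_combination (norm := abel) h_expand x y z + h_expand z x y + h_expand y z x
    - h_der x y z - h_der z x y - h_der y z x + h_jacobi x y z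
    - h_flat x y z - h_flat z x y - h_flat y z x

/-- Two additive trivariate functions on a tensor product agree if they agree on pure tensors. -/
theorem eq_of_eq_on_tmul {R M N P : Type*} [CommRing R] [AddCommGroup M] [AddCommGroup N]
    [AddCommGroup P] [Module R M] [Module R N] {f g : M ⊗[R] N → M ⊗[R] N → M ⊗[R] N → P}
    (f_add₁ : ∀ x x' y z, f (x + x') y z = f x y z + f x' y z)
    (f_add₂ : ∀ x y y' z, f x (y + y') z = f x y z + f x y' z)
    (f_add₃ : ∀ x y z z', f x y (z + z') = f x y z + f x y z')
    (g_add₁ : ∀ x x' y z, g (x + x') y z = g x y z + g x' y z)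
    (g_add₂ : ∀ x y y' z, g x (y + y') z = g x y z + g x y' z)
    (g_add₃ : ∀ x y z z', g x y (z + z') = g x y z + g x y z')
    (tmul : ∀ a₁ d₁ a₂ d₂ a₃ d₃, f (a₁ ⊗ₜ d₁) (a₂ ⊗ₜ d₂) (a₃ ⊗ₜ d₃)
      = g (a₁ ⊗ₜ d₁) (a₂ ⊗ₜ d₂) (a₃ ⊗ₜ d₃))
    (x y z : M ⊗[R] N) : f x y z = g x y z := by
  induction x with
  | zero =>
    rw [show f 0 y z = 0 by simpa using f_add₁ 0 0 y z,
      show g 0 y z = 0 by simpa using g_add₁ 0 0 y z]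
  | add x x' hx hx' => rw [f_add₁, g_add₁, hx, hx']
  | tmul a₁ d₁ =>
    induction y with
    | zero =>
      rw [show f _ 0 z = 0 by simpa using f_add₂ (a₁ ⊗ₜ d₁) 0 0 z,
        show g _ 0 z = 0 by simpa using g_add₂ (a₁ ⊗ₜ d₁) 0 0 z]
    | add y y' hy hy' => rw [f_add₂, g_add₂, hy, hy']
    | tmul a₂ d₂ =>
      induction z with
      | zero =>
        rw [show f _ _ 0 = 0 by simpa using f_add₃ (a₁ ⊗ₜ d₁) (a₂ ⊗ₜ d₂) 0 0,
          show g _ _ 0 = 0 by simpa using g_add₃ (a₁ ⊗ₜ d₁) (a₂ ⊗ₜ d₂) 0 0]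
      | add z z' hz hz' => rw [f_add₃, g_add₃, hz, hz']
      | tmul a₃ d₃ => exact tmul a₁ d₁ a₂ d₂ a₃ d₃

/-- **GpL-deformation of the J–Z post-Lie algebra**: let `𝒟 ⊆ Der(A)` be a
submodule closed under the commutator of derivations и `⋄` a flat connection
with constant torsion on `(𝒟, ⁅·,·⁆)`.  Then the deformed operations on
`A ⊗ 𝒟` form a post-Lie algebra. -/
theorem gpl_deformation_on_tensor (𝒟 : Submodule k (Derivation k A A))
    -- `𝒟` is closed under the commutator; `lb` is the induced bracket on `𝒟`:
    (lb : 𝒟 → 𝒟 → 𝒟)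
    (hlb : ∀ D₁ D₂ : 𝒟,
      (lb D₁ D₂ : Derivation k A A) = ⁅(D₁ : Derivation k A A), (D₂ : Derivation k A A)⁆)
    -- `⋄` is a bilinear operation on `𝒟`:
    (dia : 𝒟 →ₗ[k] 𝒟 →ₗ[k] 𝒟)
    -- null curvature:
    (h_flat : ∀ D₁ D₂ D₃ : 𝒟,
      dia D₁ (dia D₂ D₃) - dia D₂ (dia D₁ D₃) - dia (lb D₁ D₂) D₃ = 0)
    -- constant torsion, where `T(D₁,D₂) = D₁⋄D₂ − D₂⋄D₁ − ⁅D₁,D₂⁆`: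
    (h_const : ∀ D₁ D₂ D₃ : 𝒟,
      dia D₁ (dia D₂ D₃ - dia D₃ D₂ - lb D₂ D₃)
        - (dia (dia D₁ D₂) D₃ - dia D₃ (dia D₁ D₂) - lb (dia D₁ D₂) D₃)
        - (dia D₂ (dia D₁ D₃) - dia (dia D₁ D₃) D₂ - lb D₂ (dia D₁ D₃)) = 0)
    -- the deformed operations on `A ⊗ 𝒟` determined on pure tensors:
    (btr nb : (A ⊗[k] 𝒟) →ₗ[k] (A ⊗[k] 𝒟) →ₗ[k] (A ⊗[k] 𝒟))
    (hbtr : ∀ (a₁ a₂ : A) (D₁ D₂ : 𝒟),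
      btr (a₁ ⊗ₜ[k] D₁) (a₂ ⊗ₜ[k] D₂)
        = (a₁ * (D₁ : Derivation k A A) a₂) ⊗ₜ[k] D₂ + (a₁ * a₂) ⊗ₜ[k] (dia D₁ D₂))
    (hnb : ∀ (a₁ a₂ : A) (D₁ D₂ : 𝒟),
      nb (a₁ ⊗ₜ[k] D₁) (a₂ ⊗ₜ[k] D₂)
        = (a₁ * a₂) ⊗ₜ[k] (lb D₁ D₂ - dia D₁ D₂ + dia D₂ D₁)) :
    (∀ x y, nb x y = - nb y x)
    ∧ (∀ x y z, nb x (nb y z) + nb z (nb x y) + nb y (nb z x) = 0)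
    ∧ (∀ x y z, btr x (nb y z) = nb (btr x y) z + nb y (btr x z))
    ∧ (∀ x y z, btr (nb x y) z
        = assoc (fun u v => btr u v) x y z - assoc (fun u v => btr u v) y x z) := by
  have lb_skew (D₁ D₂ : 𝒟) : lb D₁ D₂ = -lb D₂ D₁ := by
    apply Subtype.ext
    rw [Submodule.coe_neg, hlb, hlb, lie_skew]
  let br : 𝒟 →ₗ[k] 𝒟 →ₗ[k] 𝒟 := LinearMap.mk₂ k lb
    (fun _ _ _ ↦ Subtype.ext (by simp only [hlb, Submodule.coe_add, add_lie]))
    (fun _ _ _ ↦ Subtype.ext (by simp only [hlb, Submodule.coe_smul, smul_lie]))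
    (fun _ _ _ ↦ Subtype.ext (by simp only [hlb, Submodule.coe_add, lie_add]))
    (fun _ _ _ ↦ Subtype.ext (by simp only [hlb, Submodule.coe_smul, lie_smul]))
  let N (D₁ D₂ : 𝒟) : 𝒟 := lb D₁ D₂ - dia D₁ D₂ + dia D₂ D₁
  have hN (D₁ D₂ : 𝒟) : N D₁ D₂ = lb D₁ D₂ - dia D₁ D₂ + dia D₂ D₁ := rfl
  have N_skew (D₁ D₂ : 𝒟) : N D₁ D₂ = -N D₂ D₁ := by
    rw [hN, hN, lb_skew D₁ D₂]; abel
  have N_der (D₁ D₂ D₃ : 𝒟) :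
      dia D₁ (N D₂ D₃) = N (dia D₁ D₂) D₃ + N D₂ (dia D₁ D₃) := by
    have h := h_const D₁ D₂ D₃
    simp only [hN, map_sub, map_add] at h ⊢
    linear_combination (norm := abel) -h
  have lb_jacobi (D₁ D₂ D₃ : 𝒟) :
      lb D₁ (lb D₂ D₃) + lb D₃ (lb D₁ D₂) + lb D₂ (lb D₃ D₁) = 0 := by
    apply Subtype.ext
    simp only [Submodule.coe_add, hlb, Submodule.coe_zero]
    rw [add_right_comm]
    exact lie_jacobi _ _ _
  have N_jacobi := jacobi_neg_torsion br dia lb_skew lb_jacobi h_flat N hN N_der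
  have lb_apply (D₁ D₂ : 𝒟) (a : A) : (lb D₁ D₂ : Derivation k A A) a =
      (D₁ : Derivation k A A) ((D₂ : Derivation k A A) a)
        - (D₂ : Derivation k A A) ((D₁ : Derivation k A A) a) := by
    rw [hlb, Derivation.commutator_apply]
  simp only [← hN] at hnb
  have nb_skew (x y : A ⊗[k] 𝒟) : nb x y = -nb y x := by
    induction x with
    | zero => simp
    | add x x' hx hx' => rw [map_add, LinearMap.add_apply, map_add, hx, hx', neg_add]
    | tmul a₁ D₁ =>
      induction y with
      | zero => simp
      | add y y' hy hy' => rw [map_add, map_add, LinearMap.add_apply, hy, hy', neg_add]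
      | tmul a₂ D₂ => rw [hnb, hnb, N_skew, tmul_neg, mul_comm]
  refine ⟨nb_skew, eq_of_eq_on_tmul ?_ ?_ ?_ ?_ ?_ ?_ ?_, eq_of_eq_on_tmul ?_ ?_ ?_ ?_ ?_ ?_ ?_,
    eq_of_eq_on_tmul ?_ ?_ ?_ ?_ ?_ ?_ ?_⟩
  iterate 3
    · intros; simp only [map_add, LinearMap.add_apply]; abel
  iterate 3
    · intros; exact (add_zero 0).symm
  · intro a₁ D₁ a₂ D₂ a₃ D₃
    simp only [hnb]
    rw [show a₃ * (a₁ * a₂) = a₁ * (a₂ * a₃) by ring,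
      show a₂ * (a₃ * a₁) = a₁ * (a₂ * a₃) by ring, ← tmul_add, ← tmul_add, N_jacobi, tmul_zero]
  iterate 3
    · intros; simp only [map_add, LinearMap.add_apply]
  iterate 3
    · intros; simp only [map_add, LinearMap.add_apply]; abel
  · intro a₁ D₁ a₂ D₂ a₃ D₃
    simp only [hnb, hbtr, map_add, LinearMap.add_apply, N_der, tmul_add, Derivation.leibniz,
      smul_eq_mul, mul_add, add_tmul]
    ring_nf
    abel
  iterate 3
    · intros; simp only [map_add, LinearMap.add_apply]
  iterate 3
    · intros; simp only [assoc, map_add, LinearMap.add_apply]; abel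
  · intro a₁ D₁ a₂ D₂ a₃ D₃
    have h_curv : dia (N D₁ D₂) D₃ = dia D₁ (dia D₂ D₃) - dia D₂ (dia D₁ D₃)
        - dia (dia D₁ D₂) D₃ + dia (dia D₂ D₁) D₃ := by
      have h := h_flat D₁ D₂ D₃
      simp only [hN, map_sub, map_add, LinearMap.sub_apply, LinearMap.add_apply]
      linear_combination (norm := abel) -h
    simp only [assoc, hnb, hbtr, map_add, LinearMap.add_apply, h_curv]
    simp only [hN, Submodule.coe_add, Submodule.coe_sub, Derivation.add_apply,
      Derivation.sub_apply, lb_apply, Derivation.leibniz, smul_eq_mul, mul_add, mul_sub,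
      add_tmul, sub_tmul, tmul_add, tmul_sub]
    ring_nf
    abel

end Stmt11
end

section
/- Let k be a field, A a commutative associative unital k-algebra, and 𝒟 ⊆ Der(A) a k-submodule closed under the commutator ⁅·,·⁆ of derivations. Let ⋄ : 𝒟 × 𝒟 → 𝒟 be a bilinear operation that is pre-Lie (its associator satisfies a_⋄(D₁,D₂,D₃) = a_⋄(D₂,D₁,D₃)) and whose commutator equals the commutator of derivations: D₁⋄D₂ − D₂⋄D₁ = ⁅D₁,D₂⁆ for all D₁,D₂ ∈ 𝒟. Then the bilinear operation on A ⊗[k] 𝒟 determined on pure tensors by (a₁⊗D₁) ▸ (a₂⊗D₂) := (a₁·D₁(a₂)) ⊗ D₂ + (a₁a₂) ⊗ (D₁⋄D₂) is pre-Lie: a_▸(x,y,z) = a_▸(y,x,z) for all x,y,z ∈ A⊗𝒟. -/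
set_option synthInstance.maxHeartbeats 1000000

namespace Stmt12

open TensorProduct

variable {k A : Type*} [Field k] [CommRing A] [Algebra k A]

/-- Associator of a binary operation. -/
def assoc {M : Type*} [AddCommGroup M] (op : M → M → M) (x y z : M) : M :=
  op x (op y z) - op (op x y) z

/-- The associator of the deformed product on pure tensors. -/
lemma assoc_tmul (𝒟 : Submodule k (Derivation k A A)) (dia : 𝒟 →ₗ[k] 𝒟 →ₗ[k] 𝒟)
    (btr : (A ⊗[k] 𝒟) →ₗ[k] (A ⊗[k] 𝒟) →ₗ[k] (A ⊗[k] 𝒟))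
    (hbtr : ∀ (a₁ a₂ : A) (D₁ D₂ : 𝒟),
      btr (a₁ ⊗ₜ[k] D₁) (a₂ ⊗ₜ[k] D₂)
        = (a₁ * (D₁ : Derivation k A A) a₂) ⊗ₜ[k] D₂ + (a₁ * a₂) ⊗ₜ[k] (dia D₁ D₂))
    (a b c : A) (D E F : 𝒟) :
    assoc (fun u v => btr u v) (a ⊗ₜ[k] D) (b ⊗ₜ[k] E) (c ⊗ₜ[k] F)
      = (a * b * (D.1 (E.1 c) - (dia D E).1 c)) ⊗ₜ[k] F
        + ((a * b * E.1 c) ⊗ₜ[k] dia D F + (a * b * D.1 c) ⊗ₜ[k] dia E F)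
        + (a * b * c) ⊗ₜ[k] assoc (fun u v => dia u v) D E F := by
  have leibniz (x y : A) : D.1 (x * y) = x * D.1 y + D.1 x * y := by
    rw [Derivation.leibniz, smul_eq_mul, smul_eq_mul, mul_comm y]
  simp only [assoc, hbtr, map_add, LinearMap.add_apply, leibniz, mul_add, mul_sub,
    TensorProduct.add_tmul, TensorProduct.sub_tmul, TensorProduct.tmul_sub, mul_assoc]
  abel

/-- The associator of a bilinear operation is symmetric in its first two arguments as soon as it
is so on pure tensors. -/
lemma assoc_symm_of_tmul {M N : Type*} [AddCommGroup M] [Module k M] [AddCommGroup N] [Module k N]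
    (op : (M ⊗[k] N) →ₗ[k] (M ⊗[k] N) →ₗ[k] (M ⊗[k] N))
    (h : ∀ (a b c : M) (D E F : N),
      assoc (fun u v => op u v) (a ⊗ₜ[k] D) (b ⊗ₜ[k] E) (c ⊗ₜ[k] F)
        = assoc (fun u v => op u v) (b ⊗ₜ[k] E) (a ⊗ₜ[k] D) (c ⊗ₜ[k] F))
    (x y z : M ⊗[k] N) :
    assoc (fun u v => op u v) x y z = assoc (fun u v => op u v) y x z := by
  simp only [assoc] at h ⊢
  have combine {p q r s p' q' r' s' : M ⊗[k] N} (h₁ : p - q = r - s) (h₂ : p' - q' = r' - s') :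
      p + p' - (q + q') = r + r' - (s + s') := by
    rw [add_sub_add_comm, h₁, h₂, add_sub_add_comm]
  induction x with
  | zero => simp
  | add x₁ x₂ h₁ h₂ => simpa only [map_add, LinearMap.add_apply] using combine h₁ h₂
  | tmul a D =>
    induction y with
    | zero => simp
    | add y₁ y₂ h₁ h₂ => simpa only [map_add, LinearMap.add_apply] using combine h₁ h₂
    | tmul b E =>
      induction z with
      | zero => simp
      | add z₁ z₂ h₁ h₂ => simpa only [map_add, LinearMap.add_apply] using combine h₁ h₂
      | tmul c F => exact h a b c D E F

/-- **Pre-Lie deformation of the J–Z post-Lie algebra**: if `⋄` is a pre-Lie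
product on `𝒟 ⊆ Der(A)` whose commutator is the commutator of derivations,
then the deformed product on `A ⊗ 𝒟` is pre-Lie. -/
theorem preLie_deformation_on_tensor (𝒟 : Submodule k (Derivation k A A))
    -- `𝒟` is closed under the commutator; `lb` is the induced bracket on `𝒟`:
    (lb : 𝒟 → 𝒟 → 𝒟)
    (hlb : ∀ D₁ D₂ : 𝒟,
      (lb D₁ D₂ : Derivation k A A) = ⁅(D₁ : Derivation k A A), (D₂ : Derivation k A A)⁆)
    -- `⋄` is a pre-Lie bilinear operation on `𝒟`:
    (dia : 𝒟 →ₗ[k] 𝒟 →ₗ[k] 𝒟)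
    (h_pre : ∀ D₁ D₂ D₃ : 𝒟,
      assoc (fun u v => dia u v) D₁ D₂ D₃ = assoc (fun u v => dia u v) D₂ D₁ D₃)
    -- the commutator of `⋄` is the commutator of derivations:
    (h_comm : ∀ D₁ D₂ : 𝒟, dia D₁ D₂ - dia D₂ D₁ = lb D₁ D₂)
    -- the deformed product on `A ⊗ 𝒟` determined on pure tensors:
    (btr : (A ⊗[k] 𝒟) →ₗ[k] (A ⊗[k] 𝒟) →ₗ[k] (A ⊗[k] 𝒟))
    (hbtr : ∀ (a₁ a₂ : A) (D₁ D₂ : 𝒟),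
      btr (a₁ ⊗ₜ[k] D₁) (a₂ ⊗ₜ[k] D₂)
        = (a₁ * (D₁ : Derivation k A A) a₂) ⊗ₜ[k] D₂ + (a₁ * a₂) ⊗ₜ[k] (dia D₁ D₂)) :
    ∀ x y z : A ⊗[k] 𝒟,
      assoc (fun u v => btr u v) x y z = assoc (fun u v => btr u v) y x z := by
  refine assoc_symm_of_tmul btr fun a b c D E F => ?_
  have hcomm : (dia D E).1 c - (dia E D).1 c = D.1 (E.1 c) - E.1 (D.1 c) := by
    rw [← Derivation.commutator_apply, ← hlb, ← h_comm]
    rfl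
  have hsymm : D.1 (E.1 c) - (dia D E).1 c = E.1 (D.1 c) - (dia E D).1 c := by
    linear_combination -hcomm
  rw [assoc_tmul 𝒟 dia btr hbtr, assoc_tmul 𝒟 dia btr hbtr, h_pre D E F, mul_comm b a, hsymm,
    add_comm ((a * b * E.1 c) ⊗ₜ[k] dia D F)]

end Stmt12
end

section
/- Let k be a field, A a commutative associative unital k-algebra, and 𝒟 ⊆ Der(A) a k-submodule of pairwise commuting derivations (⁅D₁,D₂⁆ = 0 for all D₁,D₂ ∈ 𝒟). Let ⋄ : 𝒟 × 𝒟 → 𝒟 be bilinear with D₁⋄(D₂⋄D₃) − D₂⋄(D₁⋄D₃) = 0 and D₁⋄(T(D₂,D₃)) − T(D₁⋄D₂,D₃) − T(D₂,D₁⋄D₃) = 0 for all D₁,D₂,D₃ ∈ 𝒟, where T(D₁,D₂) := D₁⋄D₂ − D₂⋄D₁. Then on A ⊗[k] 𝒟 the operations determined on pure tensors by (a₁⊗D₁) ▸ (a₂⊗D₂) := (a₁·D₁(a₂)) ⊗ D₂ + (a₁a₂) ⊗ (D₁⋄D₂) and ⟦a₁⊗D₁, a₂⊗D₂⟧ :=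 −(a₁a₂) ⊗ T(D₁,D₂) form a post-Lie algebra (⟦·,·⟧ is antisymmetric, satisfies Jacobi, x▸⟦y,z⟧ = ⟦x▸y,z⟧ + ⟦y,x▸z⟧, and ⟦x,y⟧▸z = a_▸(x,y,z) − a_▸(y,x,z)); and if moreover ⋄ ≡ 0, then the operation (a₁⊗D₁) ▷ (a₂⊗D₂) := (a₁·D₁(a₂)) ⊗ D₂ makes A⊗𝒟 a pre-Lie algebra. -/
set_option synthInstance.maxHeartbeats 1000000

namespace Stmt13

open TensorProduct

variable {k A : Type*} [Field k] [CommRing A] [Algebra k A]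

/-- Associator of a binary operation. -/
def assoc {M : Type*} [AddCommGroup M] (op : M → M → M) (x y z : M) : M :=
  op x (op y z) - op (op x y) z

/-- A pure tensor as a multiple of `1 ⊗ D`. -/
theorem tmul_eq_smul_one_tmul {V : Type*} [AddCommGroup V] [Module k V] (a : A) (v : V) :
    a ⊗ₜ[k] v = a • ((1 : A) ⊗ₜ[k] v) := by
  rw [smul_tmul', smul_eq_mul, mul_one]

/-- An additive identity in three tensor variables can be checked on pure tensors. -/
theorem induction_on_three {V : Type*} [AddCommGroup V] [Module k V]
    {P : A ⊗[k] V → A ⊗[k] V → A ⊗[k] V → Prop}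
    (zero_left : ∀ y z, P 0 y z) (zero_mid : ∀ x z, P x 0 z) (zero_right : ∀ x y, P x y 0)
    (tmul : ∀ (a b c : A) (u v w : V), P (a ⊗ₜ u) (b ⊗ₜ v) (c ⊗ₜ w))
    (add_left : ∀ x x' y z, P x y z → P x' y z → P (x + x') y z)
    (add_mid : ∀ x y y' z, P x y z → P x y' z → P x (y + y') z)
    (add_right : ∀ x y z z', P x y z → P x y z' → P x y (z + z')) (x y z : A ⊗[k] V) :
    P x y z := by
  induction x with
  | zero => exact zero_left y z
  | add x x' hx hx' => exact add_left x x' y z hx hx'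
  | tmul a u =>
    induction y with
    | zero => exact zero_mid _ z
    | add y y' hy hy' => exact add_mid _ y y' z hy hy'
    | tmul b v =>
      induction z with
      | zero => exact zero_right _ _
      | add z z' hz hz' => exact add_right _ _ z z' hz hz'
      | tmul c w => exact tmul a b c u v w

/-- The torsion of a flat bilinear operation with constant torsion satisfies the Jacobi identity. -/
theorem torsion_jacobi {V : Type*} [AddCommGroup V] [Module k V] (dia : V →ₗ[k] V →ₗ[k] V)
    (h_flat : ∀ u v w, dia u (dia v w) - dia v (dia u w) = 0)
    (h_const : ∀ u v w, dia u (dia v w - dia w v) - (dia (dia u v) w - dia w (dia u v))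
      - (dia v (dia u w) - dia (dia u w) v) = 0) (u v w : V) :
    (dia u (dia v w - dia w v) - dia (dia v w - dia w v) u)
      + (dia w (dia u v - dia v u) - dia (dia u v - dia v u) w)
      + (dia v (dia w u - dia u w) - dia (dia w u - dia u w) v) = 0 := by
  have h₁ := h_const u v w
  have h₂ := h_const v w u
  have h₃ := h_const w u v
  simp only [map_sub, LinearMap.sub_apply] at h₁ h₂ h₃ ⊢
  linear_combination (norm := module) h₁ + h₂ + h₃ - h_flat u v w - h_flat v w u - h_flat w u v

/-- **The case of commuting derivations**: if `𝒟 ⊆ Der(A)` consists of pairwise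
commuting derivations and `⋄` is flat with constant torsion, then the deformed
operations on `A ⊗ 𝒟` form a post-Lie algebra; if moreover `⋄ ≡ 0`, the product
`▷` alone is pre-Lie. -/
theorem commuting_derivations_postLie (𝒟 : Submodule k (Derivation k A A))
    -- the derivations in `𝒟` pairwise commute:
    (h_comm : ∀ D₁ D₂ : 𝒟, ⁅(D₁ : Derivation k A A), (D₂ : Derivation k A A)⁆ = 0)
    -- `⋄` is a bilinear operation on `𝒟`:
    (dia : 𝒟 →ₗ[k] 𝒟 →ₗ[k] 𝒟)
    -- null curvature (the bracket being zero):
    (h_flat : ∀ D₁ D₂ D₃ : 𝒟, dia D₁ (dia D₂ D₃) - dia D₂ (dia D₁ D₃) = 0)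
    -- constant torsion, where `T(D₁,D₂) := D₁⋄D₂ − D₂⋄D₁`:
    (h_const : ∀ D₁ D₂ D₃ : 𝒟,
      dia D₁ (dia D₂ D₃ - dia D₃ D₂)
        - (dia (dia D₁ D₂) D₃ - dia D₃ (dia D₁ D₂))
        - (dia D₂ (dia D₁ D₃) - dia (dia D₁ D₃) D₂) = 0)
    -- the deformed operations on `A ⊗ 𝒟` determined on pure tensors:
    (btr nb : (A ⊗[k] 𝒟) →ₗ[k] (A ⊗[k] 𝒟) →ₗ[k] (A ⊗[k] 𝒟))
    (hbtr : ∀ (a₁ a₂ : A) (D₁ D₂ : 𝒟),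
      btr (a₁ ⊗ₜ[k] D₁) (a₂ ⊗ₜ[k] D₂)
        = (a₁ * (D₁ : Derivation k A A) a₂) ⊗ₜ[k] D₂ + (a₁ * a₂) ⊗ₜ[k] (dia D₁ D₂))
    (hnb : ∀ (a₁ a₂ : A) (D₁ D₂ : 𝒟),
      nb (a₁ ⊗ₜ[k] D₁) (a₂ ⊗ₜ[k] D₂)
        = - ((a₁ * a₂) ⊗ₜ[k] (dia D₁ D₂ - dia D₂ D₁))) :
    -- `(A ⊗ 𝒟, btr, nb)` is a post-Lie algebra:
    ((∀ x y, nb x y = - nb y x)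
    ∧ (∀ x y z, nb x (nb y z) + nb z (nb x y) + nb y (nb z x) = 0)
    ∧ (∀ x y z, btr x (nb y z) = nb (btr x y) z + nb y (btr x z))
    ∧ (∀ x y z, btr (nb x y) z
        = assoc (fun u v => btr u v) x y z - assoc (fun u v => btr u v) y x z))
    -- moreover, if `⋄ ≡ 0` then `▷ (= btr)` is pre-Lie:
    ∧ ((∀ D₁ D₂ : 𝒟, dia D₁ D₂ = 0) →
        ∀ x y z : A ⊗[k] 𝒟,
          assoc (fun u v => btr u v) x y z = assoc (fun u v => btr u v) y x z) := by
  have nb_antisymm : ∀ x y, nb x y = -nb y x := by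
    intro x y
    induction x with
    | zero => simp
    | add x x' hx hx' => simp only [map_add, LinearMap.add_apply, hx, hx', neg_add]
    | tmul a D₁ =>
      induction y with
      | zero => simp
      | add y y' hy hy' => simp only [map_add, LinearMap.add_apply, hy, hy', neg_add]
      | tmul b D₂ =>
        rw [hnb, hnb, mul_comm b a, ← tmul_neg, neg_sub, neg_neg]
  have nb_jacobi : ∀ x y z, nb x (nb y z) + nb z (nb x y) + nb y (nb z x) = 0 := by
    refine induction_on_three (by simp) (by simp) (by simp) ?_ ?_ ?_ ?_
    · intro a b c D₁ D₂ D₃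
      have h := congrArg ((1 : A) ⊗ₜ[k] ·) (torsion_jacobi dia h_flat h_const D₁ D₂ D₃)
      simp only [hnb, map_neg, tmul_sub, tmul_add, tmul_zero, map_sub,
        LinearMap.sub_apply] at h ⊢
      simp only [tmul_eq_smul_one_tmul (k := k) (_ * _ : A)]
      linear_combination (norm := module) (a * b * c) • h
    all_goals
      intro _ _ _ _ h h'
      simp only [map_add, LinearMap.add_apply]
      linear_combination (norm := module) h + h'
  have btr_nb : ∀ x y z, btr x (nb y z) = nb (btr x y) z + nb y (btr x z) := by
    refine induction_on_three (by simp) (by simp) (by simp) ?_ ?_ ?_ ?_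
    · intro a b c D₁ D₂ D₃
      have h := congrArg ((1 : A) ⊗ₜ[k] ·) (h_const D₁ D₂ D₃)
      simp only [hnb, hbtr, map_neg, map_add, LinearMap.add_apply, tmul_sub, tmul_zero,
        map_sub, Derivation.leibniz, smul_eq_mul] at h ⊢
      simp only [tmul_eq_smul_one_tmul (k := k) (_ * _ : A)]
      linear_combination (norm := module) (-(a * b * c)) • h
    all_goals
      intro _ _ _ _ h h'
      simp only [map_add, LinearMap.add_apply]
      linear_combination (norm := module) h + h'
  have btr_assoc : ∀ x y z, btr (nb x y) z
      = assoc (fun u v => btr u v) x y z - assoc (fun u v => btr u v) y x z := by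
    unfold assoc
    refine induction_on_three (by simp) (by simp) (by simp) ?_ ?_ ?_ ?_
    · intro a b c D₁ D₂ D₃
      have h := congrArg ((1 : A) ⊗ₜ[k] ·) (h_flat D₁ D₂ D₃)
      have hc : (D₁ : Derivation k A A) ((D₂ : Derivation k A A) c)
          = (D₂ : Derivation k A A) ((D₁ : Derivation k A A) c) := by
        have := DFunLike.congr_fun (h_comm D₁ D₂) c
        rwa [Derivation.commutator_apply, Derivation.zero_apply, sub_eq_zero] at this
      simp only [hnb, hbtr, map_neg, map_add, LinearMap.add_apply, LinearMap.neg_apply, tmul_sub,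
        tmul_zero, map_sub, LinearMap.sub_apply, Derivation.leibniz, smul_eq_mul, hc] at h ⊢
      simp only [tmul_eq_smul_one_tmul (k := k) (_ * _ : A)]
      linear_combination (norm := module) (-(a * b * c)) • h
    all_goals
      intro _ _ _ _ h h'
      simp only [map_add, LinearMap.add_apply]
      linear_combination (norm := module) h + h'
  refine ⟨⟨nb_antisymm, nb_jacobi, btr_nb, btr_assoc⟩, fun h_dia x y z => ?_⟩
  have nb_zero : nb = 0 := by
    ext
    simp [hnb, h_dia]
  rw [← sub_eq_zero, ← btr_assoc, nb_zero]
  simp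

end Stmt13
end

section
/- Let k be a field, A a commutative associative unital k-algebra, and ⋄ : Der(A) × Der(A) → Der(A) a bilinear operation. Define Ψ from finite lists of derivations to k-linear endomorphisms of A recursively by Ψ[ ] := id and Ψ[D₀ :: l] := D₀ ∘ Ψ[l] − Σ_{0 ≤ i < length(l)} Ψ[l with its i-th entry replaced by D₀ ⋄ lᵢ]. Then for every list l = [D₁,…,Dₙ] of derivations and all b₁,b₂ ∈ A: Ψ[l](b₁·b₂) = Σ_{S ⊆ {1,…,n}} Ψ[sublist of l consisting of the entries with indices in S, in increasing order](b₁) · Ψ[sublist of l consisting of the entries with indices in the complement of S, in increasing order](b₂). -/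
namespace Stmt14

variable {k A : Type*} [Field k] [CommRing A] [Algebra k A]

/-- `Ψ` defined recursively on lists of derivations:
`Ψ[] = id` and
`Ψ[D₀ :: l] = D₀ ∘ Ψ[l] − Σᵢ Ψ[l with its i-th entry replaced by D₀ ⋄ lᵢ]`. -/
noncomputable def Psi
    (dia : Derivation k A A →ₗ[k] Derivation k A A →ₗ[k] Derivation k A A) :
    List (Derivation k A A) → (A →ₗ[k] A)
  | [] => LinearMap.id
  | D₀ :: l => (D₀ : A →ₗ[k] A) ∘ₗ Psi dia l
      - ∑ i : Fin l.length, Psi dia (l.set i (dia D₀ (l.get i)))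
termination_by l => l.length
decreasing_by
  · simp
  · simp

/-- The sublist of `l` consisting of the entries with indices in `S`, in
increasing order of index. -/
def subl {X : Type*} (l : List X) (S : Finset (Fin l.length)) : List X :=
  ((List.finRange l.length).filter (fun i => i ∈ S)).map l.get

/-- The sum of `f u v` over all ways of splitting `l` into a sublist `u` and the
complementary sublist `v`. -/
def splitSum {X M : Type*} [AddCommMonoid M] : (List X → List X → M) → List X → M
  | f, [] => f [] []
  | f, x :: l => splitSum (fun u v => f (x :: u) v) l + splitSum (fun u v => f u (x :: v)) l

/-- The sum of `f` over all lists obtained from `l` by applying `d` to one entry. -/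
def replaceSum {X M : Type*} [AddCommMonoid M] (d : X → X) : (List X → M) → List X → M
  | _, [] => 0
  | f, x :: l => f (d x :: l) + replaceSum d (fun m => f (x :: m)) l

section Sums

variable {X M N : Type*} [AddCommMonoid M] [AddCommMonoid N]

theorem splitSum_add (f g : List X → List X → M) (l : List X) :
    splitSum (fun u v => f u v + g u v) l = splitSum f l + splitSum g l := by
  induction l generalizing f g with
  | nil => rfl
  | cons x l ih => simp only [splitSum, ih]; abel

theorem map_splitSum (φ : M →+ N) (f : List X → List X → M) (l : List X) :
    φ (splitSum f l) = splitSum (fun u v => φ (f u v)) l := by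
  induction l generalizing f with
  | nil => rfl
  | cons x l ih => simp only [splitSum, map_add, ih]

theorem replaceSum_add (d : X → X) (f g : List X → M) (l : List X) :
    replaceSum d (fun m => f m + g m) l = replaceSum d f l + replaceSum d g l := by
  induction l generalizing f g with
  | nil => simp [replaceSum]
  | cons x l ih => simp only [replaceSum, ih]; abel

theorem map_replaceSum (d : X → X) (φ : M →+ N) (f : List X → M) (l : List X) :
    φ (replaceSum d f l) = replaceSum d (fun m => φ (f m)) l := by
  induction l generalizing f with
  | nil => simp [replaceSum]
  | cons x l ih => simp only [replaceSum, map_add, ih]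

theorem replaceSum_congr (d : X → X) (f g : List X → M) (l : List X)
    (h : ∀ m : List X, m.length = l.length → f m = g m) :
    replaceSum d f l = replaceSum d g l := by
  induction l generalizing f g with
  | nil => rfl
  | cons x l ih =>
    simp only [replaceSum]
    rw [h _ (by simp), ih _ _ fun m hm => h _ (by simp [hm])]

theorem sum_set_eq_replaceSum (d : X → X) (f : List X → M) (l : List X) :
    ∑ i : Fin l.length, f (l.set i (d (l.get i))) = replaceSum d f l := by
  induction l generalizing f with
  | nil => rfl
  | cons x l ih =>
    rw [replaceSum, ← ih]
    exact Fin.sum_univ_succ _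

/-- Replacing one entry and then splitting is the same as splitting and then replacing one
entry of either part. -/
theorem replaceSum_splitSum (d : X → X) (f : List X → List X → M) (l : List X) :
    replaceSum d (splitSum f) l =
      splitSum (fun u v => replaceSum d (fun m => f m v) u + replaceSum d (f u) v) l := by
  induction l generalizing f with
  | nil => simp [replaceSum, splitSum]
  | cons x l ih =>
    simp only [replaceSum, splitSum, replaceSum_add, splitSum_add]
    rw [ih, ih]
    simp only [splitSum_add]
    abel

theorem sum_finset_fin_succ {n : ℕ} (g : Finset (Fin (n + 1)) → M) :
    ∑ S, g S = ∑ S : Finset (Fin n),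
      g (insert 0 (S.map (Fin.succEmb n))) + ∑ S : Finset (Fin n), g (S.map (Fin.succEmb n)) := by
  have h : (Finset.univ : Finset (Fin n)).powerset.map
      (Finset.mapEmbedding (Fin.succEmb n)).toEmbedding =
      (Finset.univ.map (Fin.succEmb n)).powerset := by
    ext S
    simp [Finset.subset_map_iff, eq_comm]
  have h0 : (0 : Fin (n + 1)) ∉ Finset.univ.map (Fin.succEmb n) := by simp
  have huniv : (Finset.univ : Finset (Fin (n + 1))) =
      insert 0 (Finset.univ.map (Fin.succEmb n)) :=
    (Fin.univ_succ n).trans (Finset.cons_eq_insert _ _ _)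
  rw [← Finset.powerset_univ, huniv, Finset.sum_powerset_insert h0, ← h, add_comm]
  simp [Finset.sum_map]

theorem subl_cons_of_zero_mem (x : X) (l : List X) (S : Finset (Fin (x :: l).length))
    (T : Finset (Fin l.length)) (h0 : (0 : Fin (l.length + 1)) ∈ S)
    (h : ∀ i : Fin l.length, i.succ ∈ S ↔ i ∈ T) : subl (x :: l) S = x :: subl l T := by
  simp [subl, List.finRange_succ, List.filter_map, Function.comp_def, h, h0]

theorem subl_cons_of_zero_notMem (x : X) (l : List X) (S : Finset (Fin (x :: l).length))
    (T : Finset (Fin l.length)) (h0 : (0 : Fin (l.length + 1)) ∉ S)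
    (h : ∀ i : Fin l.length, i.succ ∈ S ↔ i ∈ T) : subl (x :: l) S = subl l T := by
  simp [subl, List.finRange_succ, List.filter_map, Function.comp_def, h, h0]

theorem sum_subl_eq_splitSum (f : List X → List X → M) (l : List X) :
    ∑ S : Finset (Fin l.length), f (subl l S) (subl l Sᶜ) = splitSum f l := by
  induction l generalizing f with
  | nil => simp [splitSum, subl]
  | cons x l ih =>
    rw [splitSum, ← ih, ← ih]
    refine (sum_finset_fin_succ _).trans ?_
    congr 1 <;> refine Finset.sum_congr rfl fun S _ => ?_
    · rw [subl_cons_of_zero_mem x l _ S (by simp) (by simp),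
        subl_cons_of_zero_notMem x l _ Sᶜ (by simp) (by simp)]
    · rw [subl_cons_of_zero_notMem x l _ S (by simp) (by simp),
        subl_cons_of_zero_mem x l _ Sᶜ (by simp) (by simp)]

end Sums

theorem Psi_cons_apply
    (dia : Derivation k A A →ₗ[k] Derivation k A A →ₗ[k] Derivation k A A)
    (D : Derivation k A A) (l : List (Derivation k A A)) (b : A) :
    Psi dia (D :: l) b = D (Psi dia l b) - replaceSum (dia D) (fun m => Psi dia m b) l := by
  rw [Psi, ← sum_set_eq_replaceSum]
  simp

theorem Psi_mul_eq_splitSum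
    (dia : Derivation k A A →ₗ[k] Derivation k A A →ₗ[k] Derivation k A A)
    (l : List (Derivation k A A)) (b₁ b₂ : A) :
    Psi dia l (b₁ * b₂) = splitSum (fun u v => Psi dia u b₁ * Psi dia v b₂) l := by
  induction hn : l.length generalizing l with
  | zero =>
    obtain rfl := List.eq_nil_of_length_eq_zero hn
    simp [splitSum, Psi]
  | succ n ih =>
    obtain _ | ⟨D, l⟩ := l
    · simp at hn
    have hl : l.length = n := by simpa using hn
    rw [Psi_cons_apply, ih l hl, replaceSum_congr _ _ _ l fun m hm => ih m (hm.trans hl),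
      replaceSum_splitSum, sub_eq_iff_eq_add, splitSum, ← splitSum_add, ← splitSum_add]
    refine (map_splitSum (D : A →ₗ[k] A).toAddMonoidHom _ l).trans ?_
    congr 1
    funext u v
    have hu := map_replaceSum (dia D) (AddMonoidHom.mulRight (Psi dia v b₂))
      (fun m => Psi dia m b₁) u
    have hv := map_replaceSum (dia D) (AddMonoidHom.mulLeft (Psi dia u b₁))
      (fun m => Psi dia m b₂) v
    simp only [AddMonoidHom.coe_mulRight, AddMonoidHom.coe_mulLeft] at hu hv
    rw [← hu, ← hv, Psi_cons_apply, Psi_cons_apply]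
    simp only [LinearMap.toAddMonoidHom_coe, Derivation.coeFn_coe, Derivation.leibniz, smul_eq_mul]
    ring

/-- **Multiplicativity of `Ψ`**: `Ψ[l](b₁·b₂)` is the sum over all subsets `S`
of the index set of `l` of `Ψ[l|_S](b₁) · Ψ[l|_{Sᶜ}](b₂)`. -/
theorem psi_multiplicative
    (dia : Derivation k A A →ₗ[k] Derivation k A A →ₗ[k] Derivation k A A)
    (l : List (Derivation k A A)) (b₁ b₂ : A) :
    Psi dia l (b₁ * b₂)
      = ∑ S : Finset (Fin l.length),
          Psi dia (subl l S) b₁ * Psi dia (subl l Sᶜ) b₂ := by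
  rw [Psi_mul_eq_splitSum, ← sum_subl_eq_splitSum]

end Stmt14
end

section
/- With A = MvPolynomial over the index set I := ℕ ⊕ {n : ℕ^d // n ≠ 0} and the derivations D^(n) (n ∈ ℕ^d) and ∂_i (1 ≤ i ≤ d) defined on generators as in the context, the following commutator identities hold in Der(A): ⁅D^(n), D^(m)⁆ = 0 for all n,m ∈ ℕ^d; ⁅∂_i, ∂_j⁆ = 0 for all i,j; ⁅∂_i, D^(n)⁆ = −n_i · D^(n−e_i) whenever n_i ≥ 1; and ⁅∂_i, D^(n)⁆ = 0 whenever n_i = 0 (in particular ⁅∂_i, D^(0)⁆ = 0), where ⁅X,Y⁆ := X∘Y − Y∘X. -/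
namespace Stmt15

open MvPolynomial

/-- Index set of the variables: `z_k` for `k ∈ ℕ` and `z_n` for `n ∈ ℕ^d, n ≠ 0`. -/
abbrev Idx (d : ℕ) := ℕ ⊕ {n : Fin d → ℕ // n ≠ 0}

/-- The polynomial algebra `A = ℝ[z_k, z_n]`. -/
abbrev A (d : ℕ) := MvPolynomial (Idx d) ℝ

/-- The `i`-th standard basis vector of `ℕ^d`. -/
def e (d : ℕ) (i : Fin d) : Fin d → ℕ := fun j => if j = i then 1 else 0

lemma e_ne_zero {d : ℕ} (i : Fin d) : e d i ≠ 0 := by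
  intro h
  have := congrFun h i
  simp [e] at this

lemma add_e_ne_zero {d : ℕ} (n : Fin d → ℕ) (i : Fin d) : n + e d i ≠ 0 := by
  intro h
  have := congrFun h i
  simp [e] at this

/-- The derivation `D^(0)`, with `D^(0)(z_k) = (k+1)·z_{k+1}` and `D^(0)(z_n) = 0`. -/
noncomputable def D0 (d : ℕ) : Derivation ℝ (A d) (A d) :=
  mkDerivation ℝ (fun j => match j with
    | Sum.inl k => (k + 1 : ℕ) • X (Sum.inl (k + 1))
    | Sum.inr _ => 0)

/-- The tilt derivations `D^(n)` for `n ∈ ℕ^d`: for `n ≠ 0`, `D^(n)` is the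
partial derivative with respect to `z_n`. -/
noncomputable def Dn (d : ℕ) (n : Fin d → ℕ) : Derivation ℝ (A d) (A d) :=
  if n = 0 then D0 d
  else mkDerivation ℝ (fun j => match j with
    | Sum.inl _ => 0
    | Sum.inr m => if m.1 = n then 1 else 0)

/-- The shift derivations `∂_i`, with `∂_i(z_k) = (k+1)·z_{k+1}·z_{e_i}` and
`∂_i(z_n) = (n_i+1)·z_{n+e_i}`. -/
noncomputable def pd (d : ℕ) (i : Fin d) : Derivation ℝ (A d) (A d) :=
  mkDerivation ℝ (fun j => match j with
    | Sum.inl k => (k + 1 : ℕ) • (X (Sum.inl (k + 1)) * X (Sum.inr ⟨e d i, e_ne_zero i⟩))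
    | Sum.inr m => (m.1 i + 1 : ℕ) • X (Sum.inr ⟨m.1 + e d i, add_e_ne_zero m.1 i⟩))

@[simp] lemma Dn_zero_inl {d : ℕ} (k : ℕ) :
    Dn d 0 (X (Sum.inl k)) = ((k : A d) + 1) * X (Sum.inl (k + 1)) := by
  simp [Dn, D0, mkDerivation_X]

@[simp] lemma Dn_zero_inr {d : ℕ} (m : {n : Fin d → ℕ // n ≠ 0}) :
    Dn d 0 (X (Sum.inr m)) = 0 := by
  simp [Dn, D0, mkDerivation_X]

lemma Dn_inl {d : ℕ} {n : Fin d → ℕ} (hn : n ≠ 0) (k : ℕ) :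
    Dn d n (X (Sum.inl k)) = 0 := by
  simp [Dn, hn, mkDerivation_X]

lemma Dn_inr {d : ℕ} {n : Fin d → ℕ} (hn : n ≠ 0) (m : {n : Fin d → ℕ // n ≠ 0}) :
    Dn d n (X (Sum.inr m)) = if m.1 = n then 1 else 0 := by
  simp [Dn, hn, mkDerivation_X]

@[simp] lemma pd_inl {d : ℕ} (i : Fin d) (k : ℕ) :
    pd d i (X (Sum.inl k)) =
      ((k : A d) + 1) * (X (Sum.inl (k + 1)) * X (Sum.inr ⟨e d i, e_ne_zero i⟩)) := by
  simp [pd, mkDerivation_X]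

@[simp] lemma pd_inr {d : ℕ} (i : Fin d) (m : {n : Fin d → ℕ // n ≠ 0}) :
    pd d i (X (Sum.inr m)) =
      ((m.1 i : A d) + 1) * X (Sum.inr ⟨m.1 + e d i, add_e_ne_zero m.1 i⟩) := by
  simp [pd, mkDerivation_X]

lemma Dn_comm (d : ℕ) (n m : Fin d → ℕ) : ⁅Dn d n, Dn d m⁆ = 0 := by
  apply derivation_ext
  rintro (k | l) <;> by_cases hn : n = 0 <;> by_cases hm : m = 0 <;>
    simp [Derivation.commutator_apply, Dn_inl, Dn_inr, hn, hm, apply_ite]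

lemma pd_comm (d : ℕ) (i j : Fin d) : ⁅pd d i, pd d j⁆ = 0 := by
  have e_symm : e d i j = e d j i := by simp [e, eq_comm]
  apply derivation_ext
  rintro (k | l)
  · simp only [Derivation.commutator_apply, pd_inl, pd_inr, Derivation.leibniz, map_add,
      Derivation.map_natCast, Derivation.map_one_eq_zero, smul_eq_mul, Derivation.zero_apply,
      add_comm (e d j) (e d i), e_symm]
    push_cast
    ring
  · simp only [Derivation.commutator_apply, pd_inr, Derivation.leibniz, map_add,
      Derivation.map_natCast, Derivation.map_one_eq_zero, smul_eq_mul, Derivation.zero_apply,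
      add_right_comm l.1 (e d j) (e d i), Pi.add_apply, e_symm]
    rcases eq_or_ne i j with rfl | hij
    · ring
    · simp [e, hij]
      ring

lemma pd_Dn_zero_comm (d : ℕ) (i : Fin d) : ⁅pd d i, Dn d 0⁆ = 0 := by
  apply derivation_ext
  rintro (k | l)
  · simp [Derivation.commutator_apply]
    ring
  · simp [Derivation.commutator_apply]

lemma pd_Dn_comm (d : ℕ) (i : Fin d) (n : Fin d → ℕ) (hn : 1 ≤ n i) :
    ⁅pd d i, Dn d n⁆ = -(n i : ℝ) • Dn d (n - e d i) := by
  obtain ⟨p, rfl⟩ : ∃ p, n = p + e d i := by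
    refine ⟨n - e d i, (tsub_add_cancel_of_le fun j => ?_).symm⟩
    by_cases hj : j = i
    · subst hj
      simpa [e] using hn
    · simp [e, hj]
  have hp := add_e_ne_zero p i
  rw [add_tsub_cancel_right]
  apply derivation_ext
  rintro (k | l)
  · by_cases h : p = 0
    · subst h
      simp [Derivation.commutator_apply, Dn_inl, Dn_inr, e_ne_zero, e]
    · simp [Derivation.commutator_apply, Dn_inl hp, Dn_inr hp, Dn_inl h, h]
  · by_cases h : p = 0
    · subst h
      simp [Derivation.commutator_apply, Dn_inr, e_ne_zero, l.2, apply_ite]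
    · by_cases hl : l.1 = p
      · simp [Derivation.commutator_apply, Dn_inr hp, Dn_inr h, hl, apply_ite, e,
          MvPolynomial.smul_eq_C_mul]
      · simp [Derivation.commutator_apply, Dn_inr hp, Dn_inr h, hl, apply_ite]

lemma pd_Dn_comm_of_eq_zero (d : ℕ) (i : Fin d) (n : Fin d → ℕ) (hn : n i = 0) :
    ⁅pd d i, Dn d n⁆ = 0 := by
  by_cases h : n = 0
  · subst h
    exact pd_Dn_zero_comm d i
  have hne (p : Fin d → ℕ) : p + e d i ≠ n := by
    rintro rfl
    simp [e] at hn
  have hne' : e d i ≠ n := by simpa using hne 0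
  apply derivation_ext
  rintro (k | l) <;>
    simp [Derivation.commutator_apply, Dn_inl h, Dn_inr h, hne, hne', apply_ite]

/-- **Commutator identities** between the tilt and shift derivations. -/
theorem commutator_identities (d : ℕ) (hd : 1 ≤ d) :
    (∀ n m : Fin d → ℕ, ⁅Dn d n, Dn d m⁆ = 0)
    ∧ (∀ i j : Fin d, ⁅pd d i, pd d j⁆ = 0)
    ∧ (∀ (i : Fin d) (n : Fin d → ℕ), 1 ≤ n i →
        ⁅pd d i, Dn d n⁆ = -(n i : ℝ) • Dn d (n - e d i))
    ∧ (∀ (i : Fin d) (n : Fin d → ℕ), n i = 0 → ⁅pd d i, Dn d n⁆ = 0) := by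
  exact ⟨Dn_comm d, pd_comm d, pd_Dn_comm d, pd_Dn_comm_of_eq_zero d⟩

end Stmt15
end

section
/- Let D be the free ℝ-module on the index set J := Fin d ⊕ ℕ^d, with generators denoted ∂̂_i (i ∈ Fin d) and D̂^(n) (n ∈ ℕ^d), and let ⋄ be the bilinear operation on D defined on generators by ∂̂_i ⋄ D̂^(n) := −n_i·D̂^(n−e_i) when n_i ≥ 1, with all other products of two generators (∂̂_i⋄∂̂_j, D̂^(n)⋄∂̂_i, D̂^(n)⋄D̂^(m), and ∂̂_i⋄D̂^(n) when n_i = 0) equal to 0. Then: (i) ⋄ is pre-Lie, i.e. its associator satisfies a_⋄(x,y,z) = a_⋄(y,x,z) for all x,y,z ∈ D; and (ii) the ℝ-linear map π : D → Der(A) sending ∂̂_i to ∂_i and D̂^(n) to D^(n) satisfies π(x⋄y − y⋄x) = ⁅π(x), π(y)⁆ for all x,y ∈ D, where ⁅X,Y⁆ := X∘Y − Y∘X. -/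
namespace Stmt16

open MvPolynomial

/-- Index set of the variables: `z_k` for `k ∈ ℕ` and `z_n` for `n ∈ ℕ^d, n ≠ 0`. -/
abbrev Idx (d : ℕ) := ℕ ⊕ {n : Fin d → ℕ // n ≠ 0}

/-- The polynomial algebra `A = ℝ[z_k, z_n]`. -/
abbrev A (d : ℕ) := MvPolynomial (Idx d) ℝ

/-- The `i`-th standard basis vector of `ℕ^d`. -/
def e (d : ℕ) (i : Fin d) : Fin d → ℕ := fun j => if j = i then 1 else 0

lemma e_ne_zero {d : ℕ} (i : Fin d) : e d i ≠ 0 := by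
  intro h
  have := congrFun h i
  simp [e] at this

lemma add_e_ne_zero {d : ℕ} (n : Fin d → ℕ) (i : Fin d) : n + e d i ≠ 0 := by
  intro h
  have := congrFun h i
  simp [e] at this

/-- The derivation `D^(0)`, with `D^(0)(z_k) = (k+1)·z_{k+1}` and `D^(0)(z_n) = 0`. -/
noncomputable def D0 (d : ℕ) : Derivation ℝ (A d) (A d) :=
  mkDerivation ℝ (fun j => match j with
    | Sum.inl k => (k + 1 : ℕ) • X (Sum.inl (k + 1))
    | Sum.inr _ => 0)

/-- The tilt derivations `D^(n)` for `n ∈ ℕ^d`: for `n ≠ 0`, `D^(n)` is the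
partial derivative with respect to `z_n`. -/
noncomputable def Dn (d : ℕ) (n : Fin d → ℕ) : Derivation ℝ (A d) (A d) :=
  if n = 0 then D0 d
  else mkDerivation ℝ (fun j => match j with
    | Sum.inl _ => 0
    | Sum.inr m => if m.1 = n then 1 else 0)

/-- The shift derivations `∂_i`. -/
noncomputable def pd (d : ℕ) (i : Fin d) : Derivation ℝ (A d) (A d) :=
  mkDerivation ℝ (fun j => match j with
    | Sum.inl k => (k + 1 : ℕ) • (X (Sum.inl (k + 1)) * X (Sum.inr ⟨e d i, e_ne_zero i⟩))
    | Sum.inr m => (m.1 i + 1 : ℕ) • X (Sum.inr ⟨m.1 + e d i, add_e_ne_zero m.1 i⟩))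

/-- The free `ℝ`-module on the index set `J = Fin d ⊕ ℕ^d`. -/
abbrev Dfree (d : ℕ) := (Fin d ⊕ (Fin d → ℕ)) →₀ ℝ

/-- The generators `∂̂_i` (for `Sum.inl i`) and `D̂^(n)` (for `Sum.inr n`). -/
noncomputable def gen {d : ℕ} (j : Fin d ⊕ (Fin d → ℕ)) : Dfree d :=
  Finsupp.single j (1 : ℝ)

/-- Associator of a binary operation. -/
def assoc {M : Type*} [AddCommGroup M] (op : M → M → M) (x y z : M) : M :=
  op x (op y z) - op (op x y) z

@[simp] lemma e_same {d : ℕ} (i : Fin d) : e d i i = 1 := by simp [e]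

lemma smul_gen {d : ℕ} (j : Fin d ⊕ (Fin d → ℕ)) (r : ℝ) :
    (Finsupp.single j r : Dfree d) = r • gen j := by
  simp [gen]

/-- A property of elements of `Dfree d` that is stable under linear combinations holds
everywhere as soon as it holds for the generators. -/
lemma Dfree.induction {d : ℕ} {p : Dfree d → Prop} (x : Dfree d) (zero : p 0)
    (add : ∀ u v, p u → p v → p (u + v)) (smul : ∀ (r : ℝ) u, p u → p (r • u))
    (gens : ∀ j, p (gen j)) : p x := by
  induction x using Finsupp.induction_linear with
  | zero => exact zero
  | add u v hu hv => exact add u v hu hv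
  | single j r => rw [smul_gen]; exact smul r _ (gens j)

lemma derivation_add_lie {d : ℕ} (U V W : Derivation ℝ (A d) (A d)) :
    ⁅U + V, W⁆ = ⁅U, W⁆ + ⁅V, W⁆ := add_lie U V W

lemma derivation_lie_add {d : ℕ} (U V W : Derivation ℝ (A d) (A d)) :
    ⁅U, V + W⁆ = ⁅U, V⁆ + ⁅U, W⁆ := lie_add U V W

lemma derivation_smul_lie {d : ℕ} (r : ℝ) (U V : Derivation ℝ (A d) (A d)) :
    ⁅r • U, V⁆ = r • ⁅U, V⁆ := smul_lie r U V

lemma derivation_lie_smul {d : ℕ} (r : ℝ) (U V : Derivation ℝ (A d) (A d)) :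
    ⁅U, r • V⁆ = r • ⁅U, V⁆ := lie_smul r U V

lemma derivation_zero_lie {d : ℕ} (U : Derivation ℝ (A d) (A d)) :
    ⁅(0 : Derivation ℝ (A d) (A d)), U⁆ = 0 := zero_lie U

lemma derivation_lie_zero {d : ℕ} (U : Derivation ℝ (A d) (A d)) :
    ⁅U, (0 : Derivation ℝ (A d) (A d))⁆ = 0 := lie_zero U

lemma pd_inl {d : ℕ} (i : Fin d) (k : ℕ) : pd d i (X (Sum.inl k)) =
    (k + 1 : ℕ) • (X (Sum.inl (k + 1)) * X (Sum.inr ⟨e d i, e_ne_zero i⟩)) := by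
  rw [pd, mkDerivation_X]

lemma pd_inr {d : ℕ} (i : Fin d) (m : {n : Fin d → ℕ // n ≠ 0}) : pd d i (X (Sum.inr m)) =
    (m.1 i + 1 : ℕ) • X (Sum.inr ⟨m.1 + e d i, add_e_ne_zero m.1 i⟩) := by
  rw [pd, mkDerivation_X]

lemma Dn_inl {d : ℕ} (n : Fin d → ℕ) (k : ℕ) : Dn d n (X (Sum.inl k)) =
    if n = 0 then (k + 1 : ℕ) • X (Sum.inl (k + 1)) else 0 := by
  unfold Dn D0
  split_ifs <;> rw [mkDerivation_X]

lemma Dn_inr {d : ℕ} (n : Fin d → ℕ) (m : {n : Fin d → ℕ // n ≠ 0}) :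
    Dn d n (X (Sum.inr m)) = if m.1 = n then 1 else 0 := by
  unfold Dn D0
  by_cases h : n = 0
  · rw [if_pos h, mkDerivation_X, if_neg (h ▸ m.2)]
  · rw [if_neg h, mkDerivation_X]

lemma pd_commute {d : ℕ} (i j : Fin d) : ⁅pd d i, pd d j⁆ = 0 := by
  refine derivation_ext fun v => ?_
  rw [Derivation.commutator_apply, Derivation.zero_apply, sub_eq_zero]
  rcases v with k | m
  · have hij : (⟨e d i + e d j, add_e_ne_zero _ j⟩ : {n : Fin d → ℕ // n ≠ 0}) =
        ⟨e d j + e d i, add_e_ne_zero _ i⟩ := Subtype.ext (add_comm _ _)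
    have hc : e d i j = e d j i := by simp [e, eq_comm]
    simp only [pd_inl, pd_inr, map_nsmul, Derivation.leibniz, smul_eq_mul, hij, hc]
    simp only [nsmul_eq_mul]
    ring
  · have hij : (⟨m.1 + e d i + e d j, add_e_ne_zero _ j⟩ : {n : Fin d → ℕ // n ≠ 0}) =
        ⟨m.1 + e d j + e d i, add_e_ne_zero _ i⟩ := Subtype.ext (add_right_comm _ _ _)
    simp only [pd_inr, map_nsmul, hij, Pi.add_apply, smul_smul]
    congr 1
    by_cases h : i = j
    · subst h; rfl
    · simp [e, h, Ne.symm h, mul_comm]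

lemma Dn_commute {d : ℕ} (n m : Fin d → ℕ) : ⁅Dn d n, Dn d m⁆ = 0 := by
  refine derivation_ext fun v => ?_
  rw [Derivation.commutator_apply, Derivation.zero_apply, sub_eq_zero]
  rcases v with k | p
  · by_cases hn : n = 0 <;> by_cases hm : m = 0 <;> simp [Dn_inl, hn, hm]
  · simp only [Dn_inr]
    split_ifs <;> simp

lemma pd_Dn_commutator {d : ℕ} (i : Fin d) (n : Fin d → ℕ) :
    ⁅pd d i, Dn d n⁆ = -(n i : ℝ) • Dn d (n - e d i) := by
  refine derivation_ext fun v => ?_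
  rw [Derivation.commutator_apply, Derivation.smul_apply]
  rcases v with k | m
  · by_cases hn : n = 0
    · subst hn
      simp only [Dn_inl, Dn_inr, pd_inl, Derivation.leibniz, smul_eq_mul,
        if_true, e_ne_zero, if_false, nsmul_eq_mul]
      simp
      ring
    · by_cases he : e d i = n
      · subst he
        simp [Dn_inl, Dn_inr, pd_inl, Derivation.leibniz, e_ne_zero]
      · have h : n i = 0 ∨ n - e d i ≠ 0 := by
          rw [or_iff_not_imp_left]
          intro hi h0
          refine he (funext fun j => ?_)
          have hj := congrFun h0 j
          by_cases hji : j = i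
          · subst hji
            simp [e] at hj ⊢
            omega
          · simpa [e, hji, eq_comm] using hj
        rcases h with h | h <;>
          simp [Dn_inl, Dn_inr, pd_inl, Derivation.leibniz, hn, he, h]
  · simp only [Dn_inr, pd_inr, map_nsmul]
    have h0 : pd d i (if m.1 = n then 1 else 0) = 0 := by split_ifs <;> simp
    rw [h0, zero_sub]
    by_cases h : m.1 + e d i = n
    · subst h
      simp [Algebra.smul_def]
    · have h' : n i = 0 ∨ m.1 ≠ n - e d i := by
        rw [or_iff_not_imp_left]
        intro hi hm
        refine h (funext fun j => ?_)
        rw [hm]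
        by_cases hji : j = i
        · subst hji
          simp [e]
          omega
        · simp [e, hji]
      rcases h' with h' | h' <;> simp [h, h']

/-- **The abstract diamond product is pre-Lie and is represented by the
commutator of derivations.** -/
theorem diamond_preLie_and_rep (d : ℕ) (hd : 1 ≤ d)
    -- `⋄` is the bilinear operation on `Dfree d` defined on the generators:
    (dia : Dfree d →ₗ[ℝ] Dfree d →ₗ[ℝ] Dfree d)
    (h1 : ∀ (i : Fin d) (n : Fin d → ℕ), 1 ≤ n i →
      dia (gen (Sum.inl i)) (gen (Sum.inr n)) = -(n i : ℝ) • gen (Sum.inr (n - e d i)))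
    (h2 : ∀ (i : Fin d) (n : Fin d → ℕ), n i = 0 →
      dia (gen (Sum.inl i)) (gen (Sum.inr n)) = 0)
    (h3 : ∀ i j : Fin d, dia (gen (Sum.inl i)) (gen (Sum.inl j)) = 0)
    (h4 : ∀ (n : Fin d → ℕ) (i : Fin d), dia (gen (Sum.inr n)) (gen (Sum.inl i)) = 0)
    (h5 : ∀ n m : Fin d → ℕ, dia (gen (Sum.inr n)) (gen (Sum.inr m)) = 0)
    -- `π` is the linear map sending `∂̂_i` to `∂_i` and `D̂^(n)` to `D^(n)`:
    (π : Dfree d →ₗ[ℝ] Derivation ℝ (A d) (A d))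
    (hπ1 : ∀ i : Fin d, π (gen (Sum.inl i)) = pd d i)
    (hπ2 : ∀ n : Fin d → ℕ, π (gen (Sum.inr n)) = Dn d n) :
    -- (i) `⋄` is pre-Lie:
    (∀ x y z : Dfree d,
      assoc (fun u v => dia u v) x y z = assoc (fun u v => dia u v) y x z)
    -- (ii) `π` intertwines the commutator of `⋄` and the commutator of derivations:
    ∧ (∀ x y : Dfree d, π (dia x y - dia y x) = ⁅π x, π y⁆) := by
  have h12 : ∀ (i : Fin d) (n : Fin d → ℕ),
      dia (gen (Sum.inl i)) (gen (Sum.inr n)) = -(n i : ℝ) • gen (Sum.inr (n - e d i)) := by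
    intro i n
    rcases Nat.eq_zero_or_pos (n i) with h | h
    · simp [h2 i n h, h]
    · exact h1 i n h
  have hr : ∀ n, dia (gen (Sum.inr n)) = 0 := by
    intro n
    refine LinearMap.ext fun z => ?_
    induction z using Dfree.induction with
    | zero => simp
    | add u v hu hv => simp [hu, hv]
    | smul r u hu => simp [hu]
    | gens j => rcases j with j | m <;> simp [h4, h5]
  constructor
  · intro x y z
    unfold assoc
    induction x using Dfree.induction with
    | zero => simp
    | add u v hu hv =>
      simp only [map_add, LinearMap.add_apply] at hu hv ⊢
      rw [add_sub_add_comm, add_sub_add_comm, hu, hv]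
    | smul r u hu =>
      simp only [map_smul, LinearMap.smul_apply, ← smul_sub] at hu ⊢
      rw [hu]
    | gens a =>
    induction y using Dfree.induction with
    | zero => simp
    | add u v hu hv =>
      simp only [map_add, LinearMap.add_apply] at hu hv ⊢
      rw [add_sub_add_comm, add_sub_add_comm, hu, hv]
    | smul r u hu =>
      simp only [map_smul, LinearMap.smul_apply, ← smul_sub] at hu ⊢
      rw [hu]
    | gens b =>
    induction z using Dfree.induction with
    | zero => simp
    | add u v hu hv =>
      simp only [map_add] at hu hv ⊢
      rw [add_sub_add_comm, add_sub_add_comm, hu, hv]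
    | smul r u hu =>
      simp only [map_smul, ← smul_sub] at hu ⊢
      rw [hu]
    | gens c =>
    rcases a with i | n <;> rcases b with j | m
    · rcases c with k | p
      · simp [h3]
      · simp only [h3, h12, map_smul, map_zero, LinearMap.zero_apply, sub_zero, smul_smul]
        rw [tsub_right_comm]
        congr 1
        by_cases h : i = j
        · subst h; rfl
        · simp [e, h, Ne.symm h, mul_comm]
    · simp [hr, h12]
    · simp [hr, h12]
    · simp [hr]
  · intro x y
    induction x using Dfree.induction with
    | zero =>
      simp only [map_zero, LinearMap.zero_apply, sub_zero, derivation_zero_lie]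
    | add u v hu hv =>
      simp only [map_add, map_sub, LinearMap.add_apply] at hu hv ⊢
      rw [add_sub_add_comm, hu, hv, derivation_add_lie]
    | smul r u hu =>
      simp only [map_smul, LinearMap.smul_apply, ← smul_sub]
      rw [hu, derivation_smul_lie]
    | gens a =>
    induction y using Dfree.induction with
    | zero =>
      simp only [map_zero, LinearMap.zero_apply, sub_zero, derivation_lie_zero]
    | add u v hu hv =>
      simp only [map_add, map_sub, LinearMap.add_apply] at hu hv ⊢
      rw [add_sub_add_comm, hu, hv, derivation_lie_add]
    | smul r u hu =>
      simp only [map_smul, LinearMap.smul_apply, ← smul_sub]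
      rw [hu, derivation_lie_smul]
    | gens b =>
    rcases a with i | n <;> rcases b with j | m
    · simp [h3, hπ1, pd_commute]
    · rw [h12, h4, sub_zero, map_smul, hπ1, hπ2, hπ2, pd_Dn_commutator]
    · rw [h12, h4, zero_sub, map_neg, map_smul, hπ1, hπ2, hπ2, ← pd_Dn_commutator, lie_skew]
    · simp [h5, hπ2, Dn_commute]

end Stmt16
end

section
/- Let D be the free ℝ-module on J := Fin d ⊕ ℕ^d with generators ∂̂_i, D̂^(n), the bilinear operation ⋄ on D as in the context, and π : D → Der(A) the linear map sending ∂̂_i to ∂_i and D̂^(n) to D^(n). Define the bilinear operation ▸ on A ⊗[ℝ] D determined on pure tensors by (a⊗x) ▸ (b⊗y) := (a·π(x)(b)) ⊗ y + (a·b) ⊗ (x⋄y). Then: (i) (A⊗D, ▸) is a pre-Lie algebra, i.e. a_▸(u,v,w) = a_▸(v,u,w) for all u,v,w ∈ A⊗D; and (ii) the ℝ-subspace L₀ := span({1⊗∂̂_i : 1 ≤ i ≤ d} ∪ {m⊗D̂^(n) : m a monomial of A, n ∈ ℕ^d}) is closed under ▸: u ▸ v ∈ L₀ for all u,v ∈ L₀.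 -/
set_option synthInstance.maxHeartbeats 1000000

namespace Stmt17

open MvPolynomial TensorProduct

/-- Index set of the variables: `z_k` for `k ∈ ℕ` and `z_n` for `n ∈ ℕ^d, n ≠ 0`. -/
abbrev Idx (d : ℕ) := ℕ ⊕ {n : Fin d → ℕ // n ≠ 0}

/-- The polynomial algebra `A = ℝ[z_k, z_n]`. -/
abbrev A (d : ℕ) := MvPolynomial (Idx d) ℝ

/-- The `i`-th standard basis vector of `ℕ^d`. -/
def e (d : ℕ) (i : Fin d) : Fin d → ℕ := fun j => if j = i then 1 else 0

lemma e_ne_zero {d : ℕ} (i : Fin d) : e d i ≠ 0 := by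
  intro h
  have := congrFun h i
  simp [e] at this

lemma add_e_ne_zero {d : ℕ} (n : Fin d → ℕ) (i : Fin d) : n + e d i ≠ 0 := by
  intro h
  have := congrFun h i
  simp [e] at this

/-- The derivation `D^(0)`, with `D^(0)(z_k) = (k+1)·z_{k+1}` and `D^(0)(z_n) = 0`. -/
noncomputable def D0 (d : ℕ) : Derivation ℝ (A d) (A d) :=
  mkDerivation ℝ (fun j => match j with
    | Sum.inl k => (k + 1 : ℕ) • X (Sum.inl (k + 1))
    | Sum.inr _ => 0)

/-- The tilt derivations `D^(n)` for `n ∈ ℕ^d`. -/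
noncomputable def Dn (d : ℕ) (n : Fin d → ℕ) : Derivation ℝ (A d) (A d) :=
  if n = 0 then D0 d
  else mkDerivation ℝ (fun j => match j with
    | Sum.inl _ => 0
    | Sum.inr m => if m.1 = n then 1 else 0)

/-- The shift derivations `∂_i`. -/
noncomputable def pd (d : ℕ) (i : Fin d) : Derivation ℝ (A d) (A d) :=
  mkDerivation ℝ (fun j => match j with
    | Sum.inl k => (k + 1 : ℕ) • (X (Sum.inl (k + 1)) * X (Sum.inr ⟨e d i, e_ne_zero i⟩))
    | Sum.inr m => (m.1 i + 1 : ℕ) • X (Sum.inr ⟨m.1 + e d i, add_e_ne_zero m.1 i⟩))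

/-- The free `ℝ`-module on the index set `J = Fin d ⊕ ℕ^d`. -/
abbrev Dfree (d : ℕ) := (Fin d ⊕ (Fin d → ℕ)) →₀ ℝ

/-- The generators `∂̂_i` (for `Sum.inl i`) and `D̂^(n)` (for `Sum.inr n`). -/
noncomputable def gen {d : ℕ} (j : Fin d ⊕ (Fin d → ℕ)) : Dfree d :=
  Finsupp.single j (1 : ℝ)

/-- Associator of a binary operation. -/
def assoc {M : Type*} [AddCommGroup M] (op : M → M → M) (x y z : M) : M :=
  op x (op y z) - op (op x y) z

/-- The subspace `L₀` of `A ⊗ Dfree`, spanned by the `1 ⊗ ∂̂_i` and the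
`m ⊗ D̂^(n)` with `m` a monomial of `A`. -/
noncomputable def L0 (d : ℕ) : Submodule ℝ (A d ⊗[ℝ] Dfree d) :=
  Submodule.span ℝ
    ((Set.range fun i : Fin d => (1 : A d) ⊗ₜ[ℝ] gen (Sum.inl i)) ∪
     (Set.range fun p : ((Idx d) →₀ ℕ) × (Fin d → ℕ) =>
        (monomial p.1 (1 : ℝ)) ⊗ₜ[ℝ] gen (Sum.inr p.2)))

/-- Linear induction on `Dfree d`: additive and homogeneous predicates hold everywhere once they
hold on the generators. -/
lemma Dfree_induction {d : ℕ} {P : Dfree d → Prop} (hgen : ∀ j, P (gen j))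
    (hadd : ∀ x y, P x → P y → P (x + y)) (hsmul : ∀ (r : ℝ) x, P x → P (r • x))
    (x : Dfree d) : P x := by
  induction x using Finsupp.induction_linear with
  | zero => simpa using hsmul 0 _ (hgen (Sum.inr 0))
  | add x y hx hy => exact hadd x y hx hy
  | single j r => simpa [gen] using hsmul r _ (hgen j)

lemma e_apply {d : ℕ} (i j : Fin d) : e d i j = if j = i then 1 else 0 := rfl

@[simp] lemma pd_inl {d : ℕ} (i : Fin d) (k : ℕ) :
    pd d i (X (Sum.inl k))
      = ((k : A d) + 1) * (X (Sum.inl (k + 1)) * X (Sum.inr ⟨e d i, e_ne_zero i⟩)) := by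
  simp [pd, mkDerivation_X]

@[simp] lemma pd_inr {d : ℕ} (i : Fin d) (m : {n : Fin d → ℕ // n ≠ 0}) :
    pd d i (X (Sum.inr m))
      = ((m.1 i : A d) + 1) * X (Sum.inr ⟨m.1 + e d i, add_e_ne_zero m.1 i⟩) := by
  simp [pd, mkDerivation_X]

lemma Dn_inl {d : ℕ} (n : Fin d → ℕ) (k : ℕ) :
    Dn d n (X (Sum.inl k)) = if n = 0 then ((k : A d) + 1) * X (Sum.inl (k + 1)) else 0 := by
  unfold Dn
  split_ifs <;> simp [D0, mkDerivation_X]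

lemma Dn_inr {d : ℕ} (n : Fin d → ℕ) (m : {n : Fin d → ℕ // n ≠ 0}) :
    Dn d n (X (Sum.inr m)) = if m.1 = n then 1 else 0 := by
  unfold Dn
  split_ifs with h₀ h <;> simp_all [D0, mkDerivation_X, m.2]

lemma lie_pd_pd {d : ℕ} (i j : Fin d) : ⁅pd d i, pd d j⁆ = 0 := by
  refine MvPolynomial.derivation_ext fun s => ?_
  have hsymm : ∀ m : Fin d → ℕ, m + e d i + e d j = m + e d j + e d i := fun m =>
    add_right_comm _ _ _
  rcases s with k | m
  · simp [Derivation.commutator_apply, Derivation.leibniz, e_apply, add_comm (e d i) (e d j)]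
    split_ifs with h h' h' <;> first | (exfalso; exact h' h.symm) | (exfalso; exact h h'.symm) | ring
  · simp [Derivation.commutator_apply, Derivation.leibniz, e_apply, hsymm]
    by_cases h : i = j
    · subst h; ring
    · simp [h, Ne.symm h]; ring

lemma lie_Dn_Dn {d : ℕ} (n m : Fin d → ℕ) : ⁅Dn d n, Dn d m⁆ = 0 := by
  refine MvPolynomial.derivation_ext fun s => ?_
  rcases s with k | l
  · simp only [Derivation.commutator_apply, Dn_inl]
    split_ifs <;> simp_all [Derivation.leibniz, Dn_inl]
  · simp only [Derivation.commutator_apply, Dn_inr]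
    split_ifs <;> simp

lemma lie_pd_Dn {d : ℕ} (i : Fin d) (n : Fin d → ℕ) :
    ⁅pd d i, Dn d n⁆ = -(n i : ℝ) • Dn d (n - e d i) := by
  have hle : n i ≠ 0 → e d i ≤ n := fun h j => by
    by_cases hj : j = i
    · subst hj; simp [e_apply]; omega
    · simp [e_apply, hj]
  have hsub : n i ≠ 0 → ∀ m : Fin d → ℕ, m = n - e d i ↔ m + e d i = n := fun h m =>
    eq_tsub_iff_add_eq_of_le (hle h)
  refine MvPolynomial.derivation_ext fun s => ?_
  rcases s with k | m
  · by_cases hn : n = 0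
    · subst hn
      simp [Derivation.commutator_apply, Derivation.leibniz, Dn_inl, Dn_inr, e_ne_zero]
      ring
    · by_cases hni : n i = 0
      · have : e d i ≠ n := by rintro rfl; simp [e_apply] at hni
        simp [Derivation.commutator_apply, Derivation.leibniz, Dn_inl, Dn_inr, hn, hni, this]
      · have h0 : n - e d i = 0 ↔ e d i = n := by
          rw [eq_comm, hsub hni, zero_add]
        by_cases he : e d i = n
        · subst he
          simp [Derivation.commutator_apply, Derivation.leibniz, Dn_inl, Dn_inr, e_ne_zero,
            e_apply]
        · simp [Derivation.commutator_apply, Derivation.leibniz, Dn_inl, Dn_inr, hn, h0, he]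
  · by_cases hni : n i = 0
    · have : m.1 + e d i ≠ n := by rintro rfl; simp [e_apply] at hni
      simp [Derivation.commutator_apply, Derivation.leibniz, Dn_inr, hni, this, apply_ite (pd d i)]
    · by_cases he : m.1 + e d i = n
      · subst he
        simp [Derivation.commutator_apply, Derivation.leibniz, Dn_inr, e_apply,
          apply_ite (pd d i), MvPolynomial.smul_eq_C_mul]
      · simp [Derivation.commutator_apply, Derivation.leibniz, Dn_inr, hsub hni, he,
          apply_ite (pd d i)]

/-- The product `▸` is pre-Lie as soon as `⋄` is pre-Lie and `π` is a morphism for the commutator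
brackets. -/
lemma assoc_symm_of_lie {R B V : Type*} [CommRing R] [CommRing B] [Algebra R B] [AddCommGroup V]
    [Module R V] (dia : V →ₗ[R] V →ₗ[R] V) (π : V →ₗ[R] Derivation R B B)
    (btr : (B ⊗[R] V) →ₗ[R] (B ⊗[R] V) →ₗ[R] (B ⊗[R] V))
    (hbtr : ∀ (a b : B) (x y : V),
      btr (a ⊗ₜ[R] x) (b ⊗ₜ[R] y) = (a * (π x) b) ⊗ₜ[R] y + (a * b) ⊗ₜ[R] (dia x y))
    (hdia : ∀ x y z, assoc (fun p q => dia p q) x y z = assoc (fun p q => dia p q) y x z)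
    (hlie : ∀ x y, ⁅π x, π y⁆ = π (dia x y - dia y x)) (u v w : B ⊗[R] V) :
    assoc (fun p q => btr p q) u v w = assoc (fun p q => btr p q) v u w := by
  simp only [assoc] at hdia ⊢
  induction u using TensorProduct.induction_on with
  | zero => simp
  | add u₁ u₂ h₁ h₂ =>
    simp only [map_add, LinearMap.add_apply]
    rw [add_sub_add_comm, h₁, h₂, add_sub_add_comm]
  | tmul a x =>
  induction v using TensorProduct.induction_on with
  | zero => simp
  | add u₁ u₂ h₁ h₂ =>
    simp only [map_add, LinearMap.add_apply]
    rw [add_sub_add_comm, h₁, h₂, add_sub_add_comm]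
  | tmul b y =>
  induction w using TensorProduct.induction_on with
  | zero => simp
  | add u₁ u₂ h₁ h₂ =>
    simp only [map_add]
    rw [add_sub_add_comm, h₁, h₂, add_sub_add_comm]
  | tmul c z =>
  have key : ∀ (a b : B) (x y : V),
      btr (a ⊗ₜ[R] x) (btr (b ⊗ₜ[R] y) (c ⊗ₜ[R] z))
        - btr (btr (a ⊗ₜ[R] x) (b ⊗ₜ[R] y)) (c ⊗ₜ[R] z)
      = (a * b * (π x (π y c) - π (dia x y) c)) ⊗ₜ[R] z
        + ((a * b * π y c) ⊗ₜ[R] dia x z + (a * b * π x c) ⊗ₜ[R] dia y z)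
        + (a * b * c) ⊗ₜ[R] (dia x (dia y z) - dia (dia x y) z) := by
    intro a b x y
    simp only [hbtr, map_add, LinearMap.add_apply, Derivation.leibniz, smul_eq_mul, mul_add,
      mul_sub, TensorProduct.add_tmul, TensorProduct.sub_tmul, TensorProduct.tmul_sub,
      mul_assoc, mul_comm, mul_left_comm]
    abel
  have hc : π x (π y c) - π (dia x y) c = π y (π x c) - π (dia y x) c := by
    have := DFunLike.congr_fun (hlie x y) c
    simp only [Derivation.commutator_apply, map_sub, Derivation.sub_apply] at this
    linear_combination this
  rw [key, key, hc, hdia, mul_comm a b, add_comm ((b * a * π y c) ⊗ₜ[R] dia x z)]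

lemma tmul_gen_inr_mem_L0 {d : ℕ} (a : A d) (n : Fin d → ℕ) :
    a ⊗ₜ[ℝ] gen (Sum.inr n) ∈ L0 d := by
  induction a using MvPolynomial.induction_on' with
  | monomial s r =>
    have : monomial s r ⊗ₜ[ℝ] gen (Sum.inr n)
        = r • (monomial s (1 : ℝ) ⊗ₜ[ℝ] (gen (Sum.inr n) : Dfree d)) := by
      rw [TensorProduct.smul_tmul', MvPolynomial.smul_monomial, smul_eq_mul, mul_one]
    rw [this]
    exact (L0 d).smul_mem _ (Submodule.subset_span (Or.inr ⟨(s, n), rfl⟩))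
  | add p q hp hq =>
    rw [TensorProduct.add_tmul]
    exact (L0 d).add_mem hp hq

/-- **The deformed product `▸` on `A ⊗ D` is pre-Lie, and `L₀` is closed
under it.** -/
theorem preLie_on_tensor_and_L0_closed (d : ℕ) (hd : 1 ≤ d)
    -- `⋄` is the bilinear operation on `Dfree d` defined on the generators:
    (dia : Dfree d →ₗ[ℝ] Dfree d →ₗ[ℝ] Dfree d)
    (h1 : ∀ (i : Fin d) (n : Fin d → ℕ), 1 ≤ n i →
      dia (gen (Sum.inl i)) (gen (Sum.inr n)) = -(n i : ℝ) • gen (Sum.inr (n - e d i)))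
    (h2 : ∀ (i : Fin d) (n : Fin d → ℕ), n i = 0 →
      dia (gen (Sum.inl i)) (gen (Sum.inr n)) = 0)
    (h3 : ∀ i j : Fin d, dia (gen (Sum.inl i)) (gen (Sum.inl j)) = 0)
    (h4 : ∀ (n : Fin d → ℕ) (i : Fin d), dia (gen (Sum.inr n)) (gen (Sum.inl i)) = 0)
    (h5 : ∀ n m : Fin d → ℕ, dia (gen (Sum.inr n)) (gen (Sum.inr m)) = 0)
    -- `π` is the linear map sending `∂̂_i` to `∂_i` and `D̂^(n)` to `D^(n)`:
    (π : Dfree d →ₗ[ℝ] Derivation ℝ (A d) (A d))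
    (hπ1 : ∀ i : Fin d, π (gen (Sum.inl i)) = pd d i)
    (hπ2 : ∀ n : Fin d → ℕ, π (gen (Sum.inr n)) = Dn d n)
    -- `▸` is the bilinear operation on `A ⊗ Dfree` determined on pure tensors:
    (btr : (A d ⊗[ℝ] Dfree d) →ₗ[ℝ] (A d ⊗[ℝ] Dfree d) →ₗ[ℝ] (A d ⊗[ℝ] Dfree d))
    (hbtr : ∀ (a b : A d) (x y : Dfree d),
      btr (a ⊗ₜ[ℝ] x) (b ⊗ₜ[ℝ] y)
        = (a * (π x) b) ⊗ₜ[ℝ] y + (a * b) ⊗ₜ[ℝ] (dia x y)) :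
    -- (i) `(A ⊗ Dfree, ▸)` is a pre-Lie algebra:
    (∀ u v w : A d ⊗[ℝ] Dfree d,
      assoc (fun p q => btr p q) u v w = assoc (fun p q => btr p q) v u w)
    -- (ii) `L₀` is closed under `▸`:
    ∧ (∀ u v : A d ⊗[ℝ] Dfree d, u ∈ L0 d → v ∈ L0 d → btr u v ∈ L0 d) := by
  have hdia_n : ∀ (i : Fin d) (n : Fin d → ℕ),
      dia (gen (Sum.inl i)) (gen (Sum.inr n)) = -(n i : ℝ) • gen (Sum.inr (n - e d i)) := by
    intro i n
    rcases Nat.eq_zero_or_pos (n i) with h | h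
    · simp [h2 i n h, h]
    · exact h1 i n h
  have hlie : ∀ x y, ⁅π x, π y⁆ = π (dia x y - dia y x) := by
    intro x y
    refine Derivation.ext fun c => ?_
    simp only [Derivation.commutator_apply, map_sub, Derivation.sub_apply]
    induction x using Dfree_induction with
    | hadd x₁ x₂ hx₁ hx₂ =>
      simp only [map_add, LinearMap.add_apply, Derivation.add_apply]
      linear_combination hx₁ + hx₂
    | hsmul r x hx =>
      simp only [map_smul, LinearMap.smul_apply, Derivation.smul_apply, Derivation.map_smul,
        ← smul_sub, hx]
    | hgen j =>
    induction y using Dfree_induction with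
    | hadd x₁ x₂ hx₁ hx₂ =>
      simp only [map_add, LinearMap.add_apply, Derivation.add_apply]
      linear_combination hx₁ + hx₂
    | hsmul r x hx =>
      simp only [map_smul, LinearMap.smul_apply, Derivation.smul_apply, Derivation.map_smul,
        ← smul_sub, hx]
    | hgen l =>
    rw [← Derivation.commutator_apply, ← Derivation.sub_apply, ← map_sub]
    congr 1
    rcases j with i | n <;> rcases l with j | m
    · rw [hπ1, hπ1, lie_pd_pd, h3, h3, sub_zero, map_zero]
    · rw [hπ1, hπ2, lie_pd_Dn, h4, hdia_n, sub_zero, map_smul, hπ2]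
    · rw [hπ1, hπ2, ← lie_skew, lie_pd_Dn, h4, hdia_n, zero_sub, map_neg, map_smul, hπ2]
    · rw [hπ2, hπ2, lie_Dn_Dn, h5, h5, sub_zero, map_zero]
  have hpre : ∀ x y z, assoc (fun p q => dia p q) x y z = assoc (fun p q => dia p q) y x z := by
    intro x y z
    simp only [assoc]
    induction x using Dfree_induction with
    | hadd x₁ x₂ hx₁ hx₂ =>
      simp only [map_add, LinearMap.add_apply]
      rw [add_sub_add_comm, hx₁, hx₂, add_sub_add_comm]
    | hsmul r x hx =>
      simp only [map_smul, LinearMap.smul_apply, ← smul_sub, hx]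
    | hgen j =>
    induction y using Dfree_induction with
    | hadd x₁ x₂ hx₁ hx₂ =>
      simp only [map_add, LinearMap.add_apply]
      rw [add_sub_add_comm, hx₁, hx₂, add_sub_add_comm]
    | hsmul r x hx =>
      simp only [map_smul, LinearMap.smul_apply, ← smul_sub, hx]
    | hgen l =>
    induction z using Dfree_induction with
    | hadd x₁ x₂ hx₁ hx₂ =>
      simp only [map_add]
      rw [add_sub_add_comm, hx₁, hx₂, add_sub_add_comm]
    | hsmul r x hx =>
      simp only [map_smul, ← smul_sub, hx]
    | hgen q =>
    rcases j with i | n <;> rcases l with j | m <;> rcases q with q | q <;>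
      simp only [h3, h4, h5, hdia_n, map_zero, map_smul, LinearMap.zero_apply,
        LinearMap.smul_apply, smul_zero, sub_zero]
    rw [tsub_right_comm, smul_smul, smul_smul]
    congr 1
    by_cases h : i = j
    · subst h; rfl
    · simp [e_apply, h, Ne.symm h, mul_comm]
  refine ⟨assoc_symm_of_lie dia π btr hbtr hpre hlie, fun u v hu hv => ?_⟩
  refine Submodule.map₂_le.mp (?_ : Submodule.map₂ btr (L0 d) (L0 d) ≤ L0 d) u hu v hv
  conv_lhs => rw [L0, Submodule.map₂_span_span]
  rw [Submodule.span_le]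
  rintro _ ⟨_, ⟨i, rfl⟩ | ⟨⟨s, n⟩, rfl⟩, _, ⟨j, rfl⟩ | ⟨⟨t, m⟩, rfl⟩, rfl⟩ <;>
    simp only [hbtr, h3, h4, h5, hdia_n, Derivation.map_one_eq_zero, mul_zero,
      TensorProduct.zero_tmul, TensorProduct.tmul_zero, add_zero, TensorProduct.tmul_smul,
      SetLike.mem_coe]
  · exact (L0 d).zero_mem
  · exact (L0 d).add_mem (tmul_gen_inr_mem_L0 _ _)
      ((L0 d).smul_mem _ (tmul_gen_inr_mem_L0 _ _))
  · exact (L0 d).zero_mem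
  · exact tmul_gen_inr_mem_L0 _ _

end Stmt17
end

section
/- In the setting of the context, let α ∈ (0,1) and define the homogeneity of a multi-index γ (a finitely supported function I → ℕ) by |γ| := α·Σ_{k∈ℕ} γ(k) + Σ_{n≠0} |n|·γ(n), where |n| := n₁+⋯+n_d. Let L be the ℝ-subspace of A ⊗[ℝ] D spanned by {1⊗∂̂_i : 1 ≤ i ≤ d} together with {z^γ⊗D̂^(n) : γ a multi-index, n ∈ ℕ^d, |γ| > |n|}. Then L is closed under the operation ▸ (determined on pure tensors by (a⊗x) ▸ (b⊗y) := (a·π(x)(b)) ⊗ y + (a·b) ⊗ (x⋄y)): u ▸ v ∈ L for all u,v ∈ L; in particular (L,▸) is a pre-Lie algebra. -/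
set_option synthInstance.maxHeartbeats 1000000

namespace Stmt18

open MvPolynomial TensorProduct

/-- Index set of the variables: `z_k` for `k ∈ ℕ` and `z_n` for `n ∈ ℕ^d, n ≠ 0`. -/
abbrev Idx (d : ℕ) := ℕ ⊕ {n : Fin d → ℕ // n ≠ 0}

/-- The polynomial algebra `A = ℝ[z_k, z_n]`. -/
abbrev A (d : ℕ) := MvPolynomial (Idx d) ℝ

/-- The `i`-th standard basis vector of `ℕ^d`. -/
def e (d : ℕ) (i : Fin d) : Fin d → ℕ := fun j => if j = i then 1 else 0

lemma e_ne_zero {d : ℕ} (i : Fin d) : e d i ≠ 0 := by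
  intro h
  have := congrFun h i
  simp [e] at this

lemma add_e_ne_zero {d : ℕ} (n : Fin d → ℕ) (i : Fin d) : n + e d i ≠ 0 := by
  intro h
  have := congrFun h i
  simp [e] at this

/-- The derivation `D^(0)`, with `D^(0)(z_k) = (k+1)·z_{k+1}` and `D^(0)(z_n) = 0`. -/
noncomputable def D0 (d : ℕ) : Derivation ℝ (A d) (A d) :=
  mkDerivation ℝ (fun j => match j with
    | Sum.inl k => (k + 1 : ℕ) • X (Sum.inl (k + 1))
    | Sum.inr _ => 0)

/-- The tilt derivations `D^(n)` for `n ∈ ℕ^d`. -/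
noncomputable def Dn (d : ℕ) (n : Fin d → ℕ) : Derivation ℝ (A d) (A d) :=
  if n = 0 then D0 d
  else mkDerivation ℝ (fun j => match j with
    | Sum.inl _ => 0
    | Sum.inr m => if m.1 = n then 1 else 0)

/-- The shift derivations `∂_i`. -/
noncomputable def pd (d : ℕ) (i : Fin d) : Derivation ℝ (A d) (A d) :=
  mkDerivation ℝ (fun j => match j with
    | Sum.inl k => (k + 1 : ℕ) • (X (Sum.inl (k + 1)) * X (Sum.inr ⟨e d i, e_ne_zero i⟩))
    | Sum.inr m => (m.1 i + 1 : ℕ) • X (Sum.inr ⟨m.1 + e d i, add_e_ne_zero m.1 i⟩))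

/-- The free `ℝ`-module on the index set `J = Fin d ⊕ ℕ^d`. -/
abbrev Dfree (d : ℕ) := (Fin d ⊕ (Fin d → ℕ)) →₀ ℝ

/-- The generators `∂̂_i` (for `Sum.inl i`) and `D̂^(n)` (for `Sum.inr n`). -/
noncomputable def gen {d : ℕ} (j : Fin d ⊕ (Fin d → ℕ)) : Dfree d :=
  Finsupp.single j (1 : ℝ)

/-- Associator of a binary operation. -/
def assoc {M : Type*} [AddCommGroup M] (op : M → M → M) (x y z : M) : M :=
  op x (op y z) - op (op x y) z

/-- `|n| := n₁ + ⋯ + n_d` for `n ∈ ℕ^d`. -/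
def absn {d : ℕ} (n : Fin d → ℕ) : ℕ := ∑ i, n i

/-- The homogeneity `|γ| := α·Σ_k γ(k) + Σ_{n≠0} |n|·γ(n)` of a multi-index `γ`. -/
noncomputable def homog {d : ℕ} (α : ℝ) (γ : Idx d →₀ ℕ) : ℝ :=
  γ.sum fun j m => match j with
    | Sum.inl _ => α * m
    | Sum.inr n => (absn n.1 : ℝ) * m

/-- The subspace `L` of `A ⊗ Dfree` spanned by the `1 ⊗ ∂̂_i` and the
`z^γ ⊗ D̂^(n)` with `|γ| > |n|`. -/
noncomputable def Lsp (d : ℕ) (α : ℝ) : Submodule ℝ (A d ⊗[ℝ] Dfree d) :=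
  Submodule.span ℝ
    ((Set.range fun i : Fin d => (1 : A d) ⊗ₜ[ℝ] gen (Sum.inl i)) ∪
     {x | ∃ (γ : Idx d →₀ ℕ) (n : Fin d → ℕ), (absn n : ℝ) < homog α γ ∧
        x = (monomial γ (1 : ℝ)) ⊗ₜ[ℝ] gen (Sum.inr n)})

lemma Dn_zero (d : ℕ) : Dn d 0 = D0 d := if_pos rfl

lemma D0_X_inl {d : ℕ} (k : ℕ) :
    D0 d (X (Sum.inl k)) = (k + 1 : ℕ) • X (Sum.inl (k + 1)) := by
  simp [D0, mkDerivation_X]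

lemma D0_X_inr {d : ℕ} (m : {n : Fin d → ℕ // n ≠ 0}) : D0 d (X (Sum.inr m)) = 0 := by
  simp [D0, mkDerivation_X]

lemma Dn_X_inl {d : ℕ} {n : Fin d → ℕ} (hn : n ≠ 0) (k : ℕ) : Dn d n (X (Sum.inl k)) = 0 := by
  simp [Dn, hn, mkDerivation_X]

lemma Dn_X_inr {d : ℕ} {n : Fin d → ℕ} (hn : n ≠ 0) (m : {n : Fin d → ℕ // n ≠ 0}) :
    Dn d n (X (Sum.inr m)) = if m.1 = n then 1 else 0 := by
  simp [Dn, hn, mkDerivation_X]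

lemma pd_X_inl {d : ℕ} (i : Fin d) (k : ℕ) :
    pd d i (X (Sum.inl k)) =
      (k + 1 : ℕ) • (X (Sum.inl (k + 1)) * X (Sum.inr ⟨e d i, e_ne_zero i⟩)) := by
  simp [pd, mkDerivation_X]

lemma pd_X_inr {d : ℕ} (i : Fin d) (m : {n : Fin d → ℕ // n ≠ 0}) :
    pd d i (X (Sum.inr m)) =
      (m.1 i + 1 : ℕ) • X (Sum.inr ⟨m.1 + e d i, add_e_ne_zero m.1 i⟩) := by
  simp [pd, mkDerivation_X]

lemma absn_add {d : ℕ} (m n : Fin d → ℕ) : absn (m + n) = absn m + absn n := by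
  simp [absn, Finset.sum_add_distrib]

lemma absn_e {d : ℕ} (i : Fin d) : absn (e d i) = 1 := by
  simp [absn, e]

lemma sub_e_add_e {d : ℕ} {n : Fin d → ℕ} {i : Fin d} (h : 1 ≤ n i) :
    n - e d i + e d i = n := by
  funext j
  by_cases hj : j = i
  · subst hj
    simp [e, h]
  · simp [e, hj]

/-! ### Commutators of the derivations -/

lemma pd_lie_pd {d : ℕ} (i j : Fin d) : ⁅pd d i, pd d j⁆ = 0 := by
  refine derivation_ext fun s => ?_
  rw [Derivation.commutator_apply, Derivation.zero_apply]
  rcases s with k | m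
  · simp only [pd_X_inl, pd_X_inr, map_nsmul, Derivation.leibniz, smul_eq_mul]
    have h : (⟨e d i + e d j, add_e_ne_zero _ _⟩ : {n : Fin d → ℕ // n ≠ 0}) =
        ⟨e d j + e d i, add_e_ne_zero _ _⟩ := Subtype.ext (add_comm _ _)
    have h' : e d i j = e d j i := by simp [e, eq_comm]
    rw [h, h']
    simp only [nsmul_eq_mul]
    ring
  · simp only [pd_X_inr, map_nsmul]
    have h : (⟨m.1 + e d i + e d j, add_e_ne_zero _ _⟩ : {n : Fin d → ℕ // n ≠ 0}) =
        ⟨m.1 + e d j + e d i, add_e_ne_zero _ _⟩ := Subtype.ext (add_right_comm _ _ _)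
    rw [h]
    by_cases hij : i = j
    · subst hij
      simp
    · simp only [nsmul_eq_mul, Pi.add_apply, e, hij, Ne.symm hij, if_false]
      ring

lemma Dn_lie_Dn {d : ℕ} (m n : Fin d → ℕ) : ⁅Dn d m, Dn d n⁆ = 0 := by
  refine derivation_ext fun s => ?_
  rw [Derivation.commutator_apply, Derivation.zero_apply]
  have hite : ∀ (D : Derivation ℝ (A d) (A d)) (p : Prop) [Decidable p],
      D (if p then 1 else 0) = 0 := fun D p _ => by split_ifs <;> simp
  by_cases hm : m = 0 <;> by_cases hn : n = 0 <;> rcases s with k | s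
  · simp [hm, hn]
  · simp [hm, hn]
  · simp only [hm, Dn_zero, D0_X_inl, Dn_X_inl hn, map_nsmul, map_zero, smul_zero, sub_self]
  · simp only [hm, Dn_zero, D0_X_inr, Dn_X_inr hn, hite, map_zero, sub_self]
  · simp only [hn, Dn_zero, D0_X_inl, Dn_X_inl hm, map_nsmul, map_zero, smul_zero, sub_self]
  · simp only [hn, Dn_zero, D0_X_inr, Dn_X_inr hm, hite, map_zero, sub_self]
  · simp only [Dn_X_inl hn, Dn_X_inl hm, map_zero, sub_self]
  · simp only [Dn_X_inr hn, Dn_X_inr hm, hite, sub_self]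

lemma pd_lie_Dn_of_eq_zero {d : ℕ} {i : Fin d} {n : Fin d → ℕ} (h : n i = 0) :
    ⁅pd d i, Dn d n⁆ = 0 := by
  refine derivation_ext fun s => ?_
  rw [Derivation.commutator_apply, Derivation.zero_apply]
  have hne : ∀ m : Fin d → ℕ, m + e d i ≠ n := fun m hm => by
    simpa [e, h] using congrFun hm i
  by_cases hn : n = 0
  · subst hn
    rcases s with k | s
    · simp only [Dn_zero, pd_X_inl, D0_X_inl, D0_X_inr, map_nsmul, Derivation.leibniz,
        smul_eq_mul]
      simp only [nsmul_eq_mul]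
      ring
    · simp [Dn_zero, pd_X_inr, D0_X_inr]
  · have hne' : e d i ≠ n := by simpa using hne 0
    rcases s with k | s
    · simp [pd_X_inl, Dn_X_inl hn, Dn_X_inr hn, hne']
    · simp only [pd_X_inr, Dn_X_inr hn, map_nsmul, hne, if_false]
      split_ifs <;> simp

lemma pd_lie_Dn_of_pos {d : ℕ} {i : Fin d} {n : Fin d → ℕ} (h : 1 ≤ n i) :
    ⁅pd d i, Dn d n⁆ = -(n i : ℝ) • Dn d (n - e d i) := by
  obtain ⟨m, rfl⟩ : ∃ m, n = m + e d i := ⟨n - e d i, (sub_e_add_e h).symm⟩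
  have hm : m + e d i - e d i = m := add_tsub_cancel_right m _
  have hn := add_e_ne_zero m i
  rw [hm]
  refine derivation_ext fun s => ?_
  rw [Derivation.commutator_apply, Derivation.smul_apply]
  have hval : (m + e d i) i = m i + 1 := by simp [e]
  rw [hval]
  by_cases h0 : m = 0
  · subst h0
    have h1 : ∀ s : {n : Fin d → ℕ // n ≠ 0}, s.1 + e d i ≠ 0 + e d i := fun s hs =>
      s.2 (add_right_cancel hs)
    rcases s with k | s
    · simp [Dn_zero, pd_X_inl, D0_X_inl, Dn_X_inl (e_ne_zero i), Dn_X_inr (e_ne_zero i)]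
    · simp only [Dn_zero, pd_X_inr, D0_X_inr, Dn_X_inr hn, map_nsmul, h1, if_false]
      split_ifs <;> simp
  · have h1 : e d i ≠ m + e d i := fun hs => h0 (by simpa using hs)
    rcases s with k | s
    · simp [pd_X_inl, Dn_X_inl hn, Dn_X_inr hn, Dn_X_inl h0, h1]
    · simp only [pd_X_inr, Dn_X_inr hn, Dn_X_inr h0, map_nsmul, add_left_inj]
      by_cases hs : s.1 = m
      · have h2 : (pd d i) (if s.1 = m + e d i then 1 else 0) = 0 := by split_ifs <;> simp
        rw [h2]
        simp [hs, Algebra.smul_def]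
      · split_ifs <;> simp

/-! ### The pre-Lie identity -/

lemma gen_induction {d : ℕ} {p : Dfree d → Prop} (h0 : p 0)
    (hadd : ∀ x y, p x → p y → p (x + y)) (hsmul : ∀ (r : ℝ) x, p x → p (r • x))
    (hgen : ∀ j, p (gen j)) (x : Dfree d) : p x := by
  induction x using Finsupp.induction_linear with
  | zero => exact h0
  | add x y hx hy => exact hadd x y hx hy
  | single j r =>
    have h : (Finsupp.single j r : Dfree d) = r • gen j := by simp [gen]
    rw [h]
    exact hsmul r _ (hgen j)

lemma commutator_eq_of_gen {d : ℕ} (dia : Dfree d →ₗ[ℝ] Dfree d →ₗ[ℝ] Dfree d)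
    (π : Dfree d →ₗ[ℝ] Derivation ℝ (A d) (A d))
    (h : ∀ j k, ⁅π (gen j), π (gen k)⁆ = π (dia (gen j) (gen k) - dia (gen k) (gen j)))
    (x y : Dfree d) (c : A d) :
    π x (π y c) - π (dia x y) c = π y (π x c) - π (dia y x) c := by
  induction x using gen_induction with
  | h0 => simp
  | hadd x x' hx hx' =>
    simp only [map_add, LinearMap.add_apply, Derivation.add_apply, add_sub_add_comm, hx, hx']
  | hsmul r x hx =>
    simp only [map_smul, LinearMap.smul_apply, Derivation.smul_apply, Derivation.map_smul,
      ← smul_sub, hx]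
  | hgen j =>
    induction y using gen_induction with
    | h0 => simp
    | hadd x x' hx hx' =>
      simp only [map_add, LinearMap.add_apply, Derivation.add_apply, add_sub_add_comm, hx, hx']
    | hsmul r x hx =>
      simp only [map_smul, LinearMap.smul_apply, Derivation.smul_apply, Derivation.map_smul,
        ← smul_sub, hx]
    | hgen k =>
      have := congrArg (fun D : Derivation ℝ (A d) (A d) => D c) (h j k)
      simp only [Derivation.commutator_apply, map_sub, Derivation.sub_apply] at this
      linear_combination this

lemma assoc_symm_of_gen {d : ℕ} (dia : Dfree d →ₗ[ℝ] Dfree d →ₗ[ℝ] Dfree d)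
    (h : ∀ j k l, assoc (fun p q => dia p q) (gen j) (gen k) (gen l) =
      assoc (fun p q => dia p q) (gen k) (gen j) (gen l)) (x y z : Dfree d) :
    assoc (fun p q => dia p q) x y z = assoc (fun p q => dia p q) y x z := by
  simp only [assoc] at h ⊢
  induction x using gen_induction with
  | h0 => simp
  | hadd x x' hx hx' =>
    simp only [map_add, LinearMap.add_apply, add_sub_add_comm, hx, hx']
  | hsmul r x hx => simp only [map_smul, LinearMap.smul_apply, ← smul_sub, hx]
  | hgen j =>
    induction y using gen_induction with
    | h0 => simp
    | hadd x x' hx hx' =>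
      simp only [map_add, LinearMap.add_apply, add_sub_add_comm, hx, hx']
    | hsmul r x hx => simp only [map_smul, LinearMap.smul_apply, ← smul_sub, hx]
    | hgen k =>
      induction z using gen_induction with
      | h0 => simp
      | hadd x x' hx hx' =>
        simp only [map_add, add_sub_add_comm, hx, hx']
      | hsmul r x hx => simp only [map_smul, ← smul_sub, hx]
      | hgen l => exact h j k l

lemma btr_assoc_symm {d : ℕ} (dia : Dfree d →ₗ[ℝ] Dfree d →ₗ[ℝ] Dfree d)
    (π : Dfree d →ₗ[ℝ] Derivation ℝ (A d) (A d))
    (btr : (A d ⊗[ℝ] Dfree d) →ₗ[ℝ] (A d ⊗[ℝ] Dfree d) →ₗ[ℝ] (A d ⊗[ℝ] Dfree d))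
    (hbtr : ∀ (a b : A d) (x y : Dfree d),
      btr (a ⊗ₜ[ℝ] x) (b ⊗ₜ[ℝ] y)
        = (a * (π x) b) ⊗ₜ[ℝ] y + (a * b) ⊗ₜ[ℝ] (dia x y))
    (hlie : ∀ x y c, π x (π y c) - π (dia x y) c = π y (π x c) - π (dia y x) c)
    (hdia : ∀ x y z, assoc (fun p q => dia p q) x y z = assoc (fun p q => dia p q) y x z)
    (u v w : A d ⊗[ℝ] Dfree d) :
    assoc (fun p q => btr p q) u v w = assoc (fun p q => btr p q) v u w := by
  simp only [assoc] at hdia ⊢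
  induction u using TensorProduct.induction_on with
  | zero => simp
  | add x x' hx hx' =>
    simp only [map_add, LinearMap.add_apply, add_sub_add_comm, hx, hx']
  | tmul a x =>
    induction v using TensorProduct.induction_on with
    | zero => simp
    | add x x' hx hx' =>
      simp only [map_add, LinearMap.add_apply, add_sub_add_comm, hx, hx']
    | tmul b y =>
      induction w using TensorProduct.induction_on with
      | zero => simp
      | add x x' hx hx' => simp only [map_add, add_sub_add_comm, hx, hx']
      | tmul c z =>
        have key : ∀ (a b : A d) (x y : Dfree d),
            btr (a ⊗ₜ x) (btr (b ⊗ₜ y) (c ⊗ₜ z)) - btr (btr (a ⊗ₜ x) (b ⊗ₜ y)) (c ⊗ₜ z) =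
              (a * b * (π x (π y c) - π (dia x y) c)) ⊗ₜ z
                + ((a * b * π y c) ⊗ₜ dia x z + (a * b * π x c) ⊗ₜ dia y z)
                + (a * b * c) ⊗ₜ[ℝ] (dia x (dia y z) - dia (dia x y) z) := by
          intro a b x y
          simp only [hbtr, map_add, LinearMap.add_apply, Derivation.leibniz, smul_eq_mul,
            mul_add, mul_sub, add_tmul, sub_tmul, tmul_sub]
          rw [show a * (b * π x c) = a * b * π x c by ring,
            show a * (c * π x b) = a * π x b * c by ring,
            show a * (π y c * π x b) = a * π x b * π y c by ring]
          simp only [← mul_assoc]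
          abel
        rw [key, key, hlie x y c, hdia x y z, mul_comm b a,
          add_comm ((a * b * π y c) ⊗ₜ[ℝ] dia x z)]

/-! ### Homogeneity -/

/-- The homogeneity of a single variable. -/
noncomputable def wt {d : ℕ} (α : ℝ) : Idx d → ℝ
  | Sum.inl _ => α
  | Sum.inr n => absn n.1

lemma weight_wt {d : ℕ} (α : ℝ) (γ : Idx d →₀ ℕ) : Finsupp.weight (wt α) γ = homog α γ := by
  rw [Finsupp.weight_apply, homog]
  refine Finsupp.sum_congr fun j _ => ?_
  rcases j with k | n <;> simp [wt, mul_comm]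

lemma isWeightedHomogeneous_derivation_monomial {R σ M : Type*} [CommSemiring R]
    [AddCommMonoid M] {w : σ → M} {s : M}
    {D : Derivation R (MvPolynomial σ R) (MvPolynomial σ R)}
    (h : ∀ j, IsWeightedHomogeneous w (D (X j)) (w j + s)) (γ : σ →₀ ℕ) :
    IsWeightedHomogeneous w (D (monomial γ 1)) (Finsupp.weight w γ + s) := by
  have hmul : ∀ β γ : σ →₀ ℕ,
      IsWeightedHomogeneous w (D (monomial β 1)) (Finsupp.weight w β + s) →
      IsWeightedHomogeneous w (D (monomial γ 1)) (Finsupp.weight w γ + s) →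
      IsWeightedHomogeneous w (D (monomial (β + γ) 1)) (Finsupp.weight w (β + γ) + s) := by
    intro β γ hβ hγ
    have hm : (monomial (β + γ) (1 : R)) = monomial β 1 * monomial γ 1 := by
      simp [monomial_mul]
    rw [hm, Derivation.leibniz, smul_eq_mul, smul_eq_mul, map_add]
    refine IsWeightedHomogeneous.add ?_ ?_
    · simpa [add_assoc] using (isWeightedHomogeneous_monomial w β (1 : R) rfl).mul hγ
    · simpa [add_comm, add_left_comm] using
        (isWeightedHomogeneous_monomial w γ (1 : R) rfl).mul hβ
  have hzero : IsWeightedHomogeneous w (D (monomial 0 1)) (Finsupp.weight w (0 : σ →₀ ℕ) + s) := by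
    have : D (monomial 0 1) = 0 := D.map_one_eq_zero
    rw [this]
    exact isWeightedHomogeneous_zero R w _
  induction γ using Finsupp.induction_linear with
  | zero => exact hzero
  | add β γ hβ hγ => exact hmul β γ hβ hγ
  | single j n =>
    induction n with
    | zero => simpa using hzero
    | succ n ih =>
      rw [Finsupp.single_add]
      refine hmul _ _ ih ?_
      simpa [Finsupp.weight_single, X] using h j

lemma isWeightedHomogeneous_pd {d : ℕ} (α : ℝ) (i : Fin d) (j : Idx d) :
    IsWeightedHomogeneous (wt α) (pd d i (X j)) (wt α j + 1) := by
  rcases j with k | m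
  · rw [pd_X_inl]
    refine Submodule.smul_of_tower_mem (weightedHomogeneousSubmodule ℝ (wt α) _) _ ?_
    have := (isWeightedHomogeneous_X ℝ (wt (d := d) α) (Sum.inl (k + 1))).mul
      (isWeightedHomogeneous_X ℝ (wt α) (Sum.inr ⟨e d i, e_ne_zero i⟩))
    simpa [wt, absn_e] using this
  · rw [pd_X_inr]
    refine Submodule.smul_of_tower_mem (weightedHomogeneousSubmodule ℝ (wt α) _) _ ?_
    have := isWeightedHomogeneous_X ℝ (wt (d := d) α)
      (Sum.inr ⟨m.1 + e d i, add_e_ne_zero m.1 i⟩)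
    simpa [wt, absn_add, absn_e] using this

lemma isWeightedHomogeneous_Dn {d : ℕ} (α : ℝ) (n : Fin d → ℕ) (j : Idx d) :
    IsWeightedHomogeneous (wt α) (Dn d n (X j)) (wt α j + -(absn n : ℝ)) := by
  by_cases hn : n = 0
  · subst hn
    rcases j with k | m
    · rw [Dn_zero, D0_X_inl]
      refine Submodule.smul_of_tower_mem (weightedHomogeneousSubmodule ℝ (wt α) _) _ ?_
      have := isWeightedHomogeneous_X ℝ (wt (d := d) α) (Sum.inl (k + 1))
      simpa [wt, absn] using this
    · rw [Dn_zero, D0_X_inr]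
      exact isWeightedHomogeneous_zero ℝ _ _
  · rcases j with k | m
    · rw [Dn_X_inl hn]
      exact isWeightedHomogeneous_zero ℝ _ _
    · rw [Dn_X_inr hn]
      split_ifs with h
      · have := isWeightedHomogeneous_one ℝ (wt (d := d) α)
        simpa [wt, h] using this
      · exact isWeightedHomogeneous_zero ℝ _ _

lemma tmul_mem_Lsp {d : ℕ} {α c : ℝ} {p : A d} (hp : IsWeightedHomogeneous (wt α) p c)
    {n : Fin d → ℕ} (hn : (absn n : ℝ) < c) : p ⊗ₜ[ℝ] gen (Sum.inr n) ∈ Lsp d α := by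
  rw [p.as_sum, TensorProduct.sum_tmul]
  refine Submodule.sum_mem _ fun γ hγ => ?_
  have hm : monomial γ (coeff γ p) = coeff γ p • monomial γ (1 : ℝ) := by simp [smul_monomial]
  rw [hm, ← TensorProduct.smul_tmul']
  refine Submodule.smul_mem _ _ (Submodule.subset_span (Or.inr ⟨γ, n, ?_, rfl⟩))
  rwa [← weight_wt, hp (mem_support_iff.mp hγ)]

/-- **The subspace `L` is closed under `▸`, hence `(L, ▸)` is a pre-Lie
algebra.** -/
theorem L_closed_and_preLie (d : ℕ) (hd : 1 ≤ d) (α : ℝ) (hα : α ∈ Set.Ioo (0 : ℝ) 1)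
    -- `⋄` is the bilinear operation on `Dfree d` defined on the generators:
    (dia : Dfree d →ₗ[ℝ] Dfree d →ₗ[ℝ] Dfree d)
    (h1 : ∀ (i : Fin d) (n : Fin d → ℕ), 1 ≤ n i →
      dia (gen (Sum.inl i)) (gen (Sum.inr n)) = -(n i : ℝ) • gen (Sum.inr (n - e d i)))
    (h2 : ∀ (i : Fin d) (n : Fin d → ℕ), n i = 0 →
      dia (gen (Sum.inl i)) (gen (Sum.inr n)) = 0)
    (h3 : ∀ i j : Fin d, dia (gen (Sum.inl i)) (gen (Sum.inl j)) = 0)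
    (h4 : ∀ (n : Fin d → ℕ) (i : Fin d), dia (gen (Sum.inr n)) (gen (Sum.inl i)) = 0)
    (h5 : ∀ n m : Fin d → ℕ, dia (gen (Sum.inr n)) (gen (Sum.inr m)) = 0)
    -- `π` is the linear map sending `∂̂_i` to `∂_i` and `D̂^(n)` to `D^(n)`:
    (π : Dfree d →ₗ[ℝ] Derivation ℝ (A d) (A d))
    (hπ1 : ∀ i : Fin d, π (gen (Sum.inl i)) = pd d i)
    (hπ2 : ∀ n : Fin d → ℕ, π (gen (Sum.inr n)) = Dn d n)
    -- `▸` is the bilinear operation on `A ⊗ Dfree` determined on pure tensors: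
    (btr : (A d ⊗[ℝ] Dfree d) →ₗ[ℝ] (A d ⊗[ℝ] Dfree d) →ₗ[ℝ] (A d ⊗[ℝ] Dfree d))
    (hbtr : ∀ (a b : A d) (x y : Dfree d),
      btr (a ⊗ₜ[ℝ] x) (b ⊗ₜ[ℝ] y)
        = (a * (π x) b) ⊗ₜ[ℝ] y + (a * b) ⊗ₜ[ℝ] (dia x y)) :
    -- `L` is closed under `▸`:
    (∀ u v : A d ⊗[ℝ] Dfree d, u ∈ Lsp d α → v ∈ Lsp d α → btr u v ∈ Lsp d α)
    -- in particular `(L, ▸)` is a pre-Lie algebra: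
    ∧ (∀ u v w : A d ⊗[ℝ] Dfree d, u ∈ Lsp d α → v ∈ Lsp d α → w ∈ Lsp d α →
        assoc (fun p q => btr p q) u v w = assoc (fun p q => btr p q) v u w) := by
  refine ⟨fun u v hu hv => ?_, fun u v w _ _ _ => ?_⟩
  · induction hu, hv using Submodule.span_induction₂ with
    | zero_left => simp
    | zero_right => simp
    | add_left x y z _ _ _ hx hy =>
      rw [map_add]
      exact add_mem hx hy
    | add_right x y z _ _ _ hx hy =>
      rw [map_add]
      exact add_mem hx hy
    | smul_left r x y _ _ hx =>
      rw [map_smul]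
      exact Submodule.smul_mem _ r hx
    | smul_right r x y _ _ hx =>
      rw [map_smul]
      exact Submodule.smul_mem _ r hx
    | mem_mem x y hx hy =>
      rcases hx with ⟨i, rfl⟩ | ⟨γ, n, hγ, rfl⟩ <;> rcases hy with ⟨j, rfl⟩ | ⟨β, m, hβ, rfl⟩
      · simp [hbtr, h3]
      · rw [hbtr, hπ1, one_mul, one_mul]
        have hD := isWeightedHomogeneous_derivation_monomial (isWeightedHomogeneous_pd α i) β
        rw [weight_wt] at hD
        refine add_mem (tmul_mem_Lsp hD (by linarith)) ?_
        rcases Nat.eq_zero_or_pos (m i) with h0 | h0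
        · simp [h2 i m h0]
        · rw [h1 i m h0, TensorProduct.tmul_smul]
          refine Submodule.smul_mem _ _ (tmul_mem_Lsp
            (isWeightedHomogeneous_monomial _ _ _ (weight_wt α β)) ?_)
          have := absn_add (m - e d i) (e d i)
          rw [sub_e_add_e h0, absn_e] at this
          have : (absn m : ℝ) = absn (m - e d i) + 1 := by exact_mod_cast this
          linarith
      · simp [hbtr, h4]
      · rw [hbtr, hπ2, h5, TensorProduct.tmul_zero, add_zero]
        have hD := isWeightedHomogeneous_derivation_monomial (isWeightedHomogeneous_Dn α n) β
        rw [weight_wt] at hD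
        exact tmul_mem_Lsp
          ((isWeightedHomogeneous_monomial _ _ (1 : ℝ) (weight_wt α γ)).mul hD) (by linarith)
  · refine btr_assoc_symm dia π btr hbtr (commutator_eq_of_gen dia π ?_)
      (assoc_symm_of_gen dia ?_) u v w
    · have hpn : ∀ i n, ⁅pd d i, Dn d n⁆ = π (dia (gen (Sum.inl i)) (gen (Sum.inr n))) := by
        intro i n
        rcases Nat.eq_zero_or_pos (n i) with h0 | h0
        · rw [pd_lie_Dn_of_eq_zero h0, h2 i n h0, map_zero]
        · rw [pd_lie_Dn_of_pos h0, h1 i n h0, map_smul, hπ2]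
      rintro (i | n) (j | m)
      · simp [hπ1, h3, pd_lie_pd]
      · rw [hπ1, hπ2, h4, sub_zero, hpn]
      · rw [hπ1, hπ2, h4, zero_sub, map_neg, ← hpn, lie_skew]
      · simp [hπ2, h5, Dn_lie_Dn]
    · have hni : ∀ n y, dia (gen (Sum.inr n)) y = 0 := by
        intro n y
        induction y using gen_induction with
        | h0 => simp
        | hadd x y hx hy => simp [hx, hy]
        | hsmul r x hx => simp [hx]
        | hgen j => rcases j with j | m <;> simp [h4, h5]
      have hin : ∀ i n z, dia (dia (gen (Sum.inl i)) (gen (Sum.inr n))) z = 0 := by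
        intro i n z
        rcases Nat.eq_zero_or_pos (n i) with h0 | h0
        · simp [h2 i n h0]
        · simp [h1 i n h0, hni]
      rintro (i | n) (j | m) (k | l) <;> simp only [assoc, hni, hin, h3, map_zero,
        LinearMap.zero_apply, sub_zero]
      have hcomm : ∀ i j, i ≠ j → dia (gen (Sum.inl i)) (dia (gen (Sum.inl j)) (gen (Sum.inr l)))
          = ((l i : ℝ) * l j) • gen (Sum.inr (l - e d i - e d j)) := by
        intro i j hij
        have hl : (l - e d j) i = l i := by simp [e, hij]
        rcases Nat.eq_zero_or_pos (l j) with h0 | h0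
        · simp [h2 j l h0, h0]
        · rw [h1 j l h0, map_smul]
          rcases Nat.eq_zero_or_pos (l i) with h0' | h0'
          · rw [h2 i _ (hl.trans h0'), h0']
            simp
          · rw [h1 i _ (hl.symm ▸ h0'), hl, smul_smul, tsub_right_comm]
            congr 1
            ring
      by_cases hij : i = j
      · rw [hij]
      · rw [hcomm i j hij, hcomm j i (Ne.symm hij), tsub_right_comm, mul_comm]

end Stmt18
end
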